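/- arXiv:1503.09174 — 2 statements merged into one kernel-verified Lean document; each statement's English description precedes it below -/
import Mathlib

section
/- Let A ⊆ ℕ be a nonempty set with A ≠ {1}. For every integer k ≥ 1, the ratio #{P ∈ ℕℂ^A_n : the block of P containing the element 1 has size k} / #ℕℂ^A_n converges to k·π_A(k) as n → ∞ along the set of integers n for which ℕℂ^A_n is nonempty. -/
open scoped Classical

/-- `P` is a set partition of `[n] = {1, …, n}`: its blocks are nonempty subsets of
`{1, …, n}` and every element of `{1, …, n}` lies in exactly one block. -/
def IsPartitionOf (n : ℕ) (P : Finset (Finset ℕ)) : Prop :=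
  (∀ B ∈ P, B ⊆ Finset.Icc 1 n ∧ B.Nonempty) ∧
    ∀ x ∈ Finset.Icc 1 n, ∃! B, B ∈ P ∧ x ∈ B

/-- A partition is non-crossing when there are no `a < b < c < d` with `a, c` in one
block and `b, d` in another, distinct block. -/
def IsNonCrossing (P : Finset (Finset ℕ)) : Prop :=
  ∀ B ∈ P, ∀ B' ∈ P, B ≠ B' →
    ∀ a b c d : ℕ, a < b → b < c → c < d →
      a ∈ B → c ∈ B → b ∈ B' → d ∈ B' → False

/-- The (finite) set of non-crossing partitions of `[n]`. -/
noncomputable def NCP (n : ℕ) : Finset (Finset (Finset ℕ)) :=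
  (Finset.Icc 1 n).powerset.powerset.filter fun P => IsPartitionOf n P ∧ IsNonCrossing P

/-- The set of non-crossing partitions of `[n]` all of whose block sizes belong to `A`. -/
noncomputable def NCPA (A : Set ℕ) (n : ℕ) : Finset (Finset (Finset ℕ)) :=
  (NCP n).filter fun P => ∀ B ∈ P, B.card ∈ A

/-- The probability measure `π_A` on `ℤ₊` associated with `A` and `ξ = ξ_A`. -/
noncomputable def piA (A : Set ℕ) (ξ : ℝ) (k : ℕ) : ℝ :=
  if k = 0 ∨ k ∈ A then ξ ^ k / (1 + ∑' i : A, ξ ^ (i : ℕ)) else 0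

theorem mem_NCPA_iff {A : Set ℕ} {n : ℕ} {P : Finset (Finset ℕ)} :
    P ∈ NCPA A n ↔ IsPartitionOf n P ∧ IsNonCrossing P ∧ ∀ B ∈ P, B.card ∈ A := by
  simp only [NCPA, NCP, Finset.mem_filter, Finset.mem_powerset]
  constructor
  · rintro ⟨⟨-, h1, h2⟩, h3⟩
    exact ⟨h1, h2, h3⟩
  · rintro ⟨h1, h2, h3⟩
    exact ⟨⟨fun B hB => Finset.mem_powerset.2 (h1.1 B hB).1, h1, h2⟩, h3⟩

namespace IsPartitionOf

variable {n : ℕ} {P : Finset (Finset ℕ)}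

theorem eq_of_mem (h : IsPartitionOf n P) {B C : Finset ℕ} (hB : B ∈ P) (hC : C ∈ P) {x : ℕ}
    (hxB : x ∈ B) (hxC : x ∈ C) : B = C :=
  (h.2 x ((h.1 B hB).1 hxB)).unique ⟨hB, hxB⟩ ⟨hC, hxC⟩

theorem exists_mem (h : IsPartitionOf n P) {x : ℕ} (h1 : 1 ≤ x) (hn : x ≤ n) :
    ∃ B ∈ P, x ∈ B :=
  (h.2 x (Finset.mem_Icc.2 ⟨h1, hn⟩)).exists

theorem pos_of_mem (h : IsPartitionOf n P) {B : Finset ℕ} (hB : B ∈ P) {x : ℕ} (hx : x ∈ B) :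
    1 ≤ x :=
  (Finset.mem_Icc.1 ((h.1 B hB).1 hx)).1

theorem le_of_mem (h : IsPartitionOf n P) {B : Finset ℕ} (hB : B ∈ P) {x : ℕ} (hx : x ∈ B) :
    x ≤ n :=
  (Finset.mem_Icc.1 ((h.1 B hB).1 hx)).2

theorem pairwiseDisjoint (h : IsPartitionOf n P) : (P : Set (Finset ℕ)).PairwiseDisjoint id :=
  fun _ hB _ hC hne => Finset.disjoint_left.2 fun _ hxB hxC => hne (h.eq_of_mem hB hC hxB hxC)

theorem biUnion_eq (h : IsPartitionOf n P) : P.biUnion id = Finset.Icc 1 n := by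
  ext x
  simp only [Finset.mem_biUnion, id]
  exact ⟨fun ⟨B, hB, hx⟩ => (h.1 B hB).1 hx, fun hx => (h.2 x hx).exists⟩

theorem sum_card (h : IsPartitionOf n P) : ∑ B ∈ P, B.card = n := by
  have := Finset.card_biUnion h.pairwiseDisjoint
  rw [h.biUnion_eq] at this
  simpa using this.symm

end IsPartitionOf

/-- The smallest element of a block. -/
noncomputable def opener (B : Finset ℕ) : ℕ := sInf (B : Set ℕ)

theorem opener_mem {B : Finset ℕ} (hB : B.Nonempty) : opener B ∈ B :=
  Finset.mem_coe.1 (Nat.sInf_mem (Finset.coe_nonempty.2 hB))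

theorem opener_le {B : Finset ℕ} {x : ℕ} (hx : x ∈ B) : opener B ≤ x :=
  Nat.sInf_le (Finset.mem_coe.2 hx)

/-- The size of the block whose smallest element is `i`, or `0` if there is none. -/
noncomputable def openerSize (P : Finset (Finset ℕ)) (i : ℕ) : ℕ :=
  ∑ B ∈ P with opener B = i, B.card

namespace IsPartitionOf

variable {n : ℕ} {P Q : Finset (Finset ℕ)}

theorem opener_injOn (h : IsPartitionOf n P) : Set.InjOn opener (P : Set (Finset ℕ)) := by
  intro B hB C hC hBC
  refine h.eq_of_mem hB hC (opener_mem (h.1 B hB).2) ?_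
  rw [hBC]
  exact opener_mem (h.1 C hC).2

theorem filter_opener (h : IsPartitionOf n P) {B : Finset ℕ} (hB : B ∈ P) :
    P.filter (fun C => opener C = opener B) = {B} := by
  ext C
  simp only [Finset.mem_filter, Finset.mem_singleton]
  exact ⟨fun hC => h.opener_injOn hC.1 hB hC.2, fun hC => by subst hC; exact ⟨hB, rfl⟩⟩

theorem openerSize_opener (h : IsPartitionOf n P) {B : Finset ℕ} (hB : B ∈ P) :
    openerSize P (opener B) = B.card := by
  rw [openerSize, h.filter_opener hB, Finset.sum_singleton]

theorem eq_zero_or_exists (P : Finset (Finset ℕ)) (i : ℕ) :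
    P.filter (fun C => opener C = i) = ∅ ∨ ∃ B ∈ P, opener B = i := by
  rcases Finset.eq_empty_or_nonempty (P.filter (fun C => opener C = i)) with h | ⟨B, hB⟩
  · exact Or.inl h
  · exact Or.inr ⟨B, Finset.mem_filter.1 hB⟩

/-- If `P` and `Q` agree on the blocks opening after `i`, then a block of `P` and a block of `Q`
that both open at `i` cannot first differ at an element `b` of the latter. -/
theorem not_lt_of_agree (hP : IsPartitionOf n P) (hQ : IsPartitionOf n Q) (hPc : IsNonCrossing P)
    {B B' : Finset ℕ} (hB : B ∈ P) (hB' : B' ∈ Q) (hop : opener B = opener B')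
    (hagree : ∀ C ∈ P, opener B < opener C → C ∈ Q) {b b' : ℕ} (hbB' : b ∈ B') (hbB : b ∉ B)
    (hb'B : b' ∈ B) : ¬ b < b' := by
  intro hlt
  obtain ⟨D, hD, hbD⟩ := hP.exists_mem (hQ.pos_of_mem hB' hbB') (hQ.le_of_mem hB' hbB')
  have hDB : D ≠ B := fun h => hbB (h ▸ hbD)
  have hBb : opener B < b := by
    refine lt_of_le_of_ne (hop ▸ opener_le hbB') fun h => hbB ?_
    rw [← h]
    exact opener_mem (hP.1 B hB).2
  rcases lt_trichotomy (opener D) (opener B) with h | h | h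
  · exact hPc D hD B hB hDB _ _ _ _ h hBb hlt (opener_mem (hP.1 D hD).2)
      hbD (opener_mem (hP.1 B hB).2) hb'B
  · exact hDB (hP.opener_injOn hD hB h)
  · have := hQ.eq_of_mem (hagree D hD h) hB' hbD hbB'
    rw [this, hop] at h
    exact lt_irrefl _ h

theorem eq_of_agree (hP : IsPartitionOf n P) (hQ : IsPartitionOf n Q) (hPc : IsNonCrossing P)
    (hQc : IsNonCrossing Q) {B B' : Finset ℕ} (hB : B ∈ P) (hB' : B' ∈ Q)
    (hop : opener B = opener B') (hcard : B.card = B'.card)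
    (hPQ : ∀ C ∈ P, opener B < opener C → C ∈ Q)
    (hQP : ∀ C ∈ Q, opener B < opener C → C ∈ P) : B = B' := by
  by_contra hne
  obtain ⟨b', hb'B, hb'B'⟩ := Finset.not_subset.1
    fun h => hne (Finset.eq_of_subset_of_card_le h hcard.ge)
  obtain ⟨b, hbB', hbB⟩ := Finset.not_subset.1
    fun h => hne (Finset.eq_of_subset_of_card_le h hcard.le).symm
  have h1 := not_lt_of_agree hP hQ hPc hB hB' hop hPQ hbB' hbB hb'B
  have h2 := not_lt_of_agree hQ hP hQc hB' hB hop.symm (hop ▸ hQP) hb'B hb'B' hbB'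
  have : b = b' := by omega
  exact hbB (this ▸ hb'B)

theorem mem_of_openerSize_eq (hP : IsPartitionOf n P) (hQ : IsPartitionOf n Q)
    (hPc : IsNonCrossing P) (hQc : IsNonCrossing Q)
    (h : ∀ i ∈ Finset.Icc 1 n, openerSize P i = openerSize Q i) (d : ℕ) :
    (∀ B ∈ P, n < opener B + d → B ∈ Q) ∧ (∀ B ∈ Q, n < opener B + d → B ∈ P) := by
  induction d with
  | zero =>
    refine ⟨fun B hB hd => ?_, fun B hB hd => ?_⟩
    · have := hP.le_of_mem hB (opener_mem (hP.1 B hB).2)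
      omega
    · have := hQ.le_of_mem hB (opener_mem (hQ.1 B hB).2)
      omega
  | succ d ih =>
    have key : ∀ {P Q : Finset (Finset ℕ)}, IsPartitionOf n P → IsPartitionOf n Q →
        IsNonCrossing P → IsNonCrossing Q →
        (∀ i ∈ Finset.Icc 1 n, openerSize P i = openerSize Q i) →
        (∀ B ∈ P, n < opener B + d → B ∈ Q) → (∀ B ∈ Q, n < opener B + d → B ∈ P) →
        ∀ B ∈ P, n < opener B + (d + 1) → B ∈ Q := by
      intro P Q hP hQ hPc hQc h h1 h2 B hB hd
      have hs := h _ ((hP.1 B hB).1 (opener_mem (hP.1 B hB).2))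
      rw [hP.openerSize_opener hB] at hs
      rcases eq_zero_or_exists Q (opener B) with h0 | ⟨B', hB', hop⟩
      · rw [openerSize, h0, Finset.sum_empty, Finset.card_eq_zero] at hs
        exact absurd hs (hP.1 B hB).2.ne_empty
      · rw [← hop, hQ.openerSize_opener hB'] at hs
        rw [eq_of_agree hP hQ hPc hQc hB hB' hop.symm hs
          (fun C hC hlt => h1 C hC (by omega)) (fun C hC hlt => h2 C hC (by omega))]
        exact hB'
    exact ⟨key hP hQ hPc hQc h ih.1 ih.2,
      key hQ hP hQc hPc (fun i hi => (h i hi).symm) ih.2 ih.1⟩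

/-- A non-crossing partition is determined by the sizes of its blocks listed by their
smallest elements. -/
theorem eq_of_openerSize_eq (hP : IsPartitionOf n P) (hQ : IsPartitionOf n Q)
    (hPc : IsNonCrossing P) (hQc : IsNonCrossing Q)
    (h : ∀ i ∈ Finset.Icc 1 n, openerSize P i = openerSize Q i) : P = Q := by
  have hm := mem_of_openerSize_eq hP hQ hPc hQc h (n + 1)
  ext B
  exact ⟨fun hB => hm.1 B hB (by omega), fun hB => hm.2 B hB (by omega)⟩

theorem prod_openerSize (h : IsPartitionOf n P) {ω : ℕ → ℝ} (h0 : ω 0 = 1) :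
    ∏ i ∈ Finset.Icc 1 n, ω (openerSize P i) = ∏ B ∈ P, ω B.card := by
  rw [← Finset.prod_fiberwise_of_maps_to (g := opener) (t := Finset.Icc 1 n)
    fun B hB => (h.1 B hB).1 (opener_mem (h.1 B hB).2)]
  refine Finset.prod_congr rfl fun i _ => ?_
  rcases eq_zero_or_exists P i with hi | ⟨B, hB, rfl⟩
  · rw [openerSize, hi, Finset.sum_empty, Finset.prod_empty, h0]
  · rw [h.openerSize_opener hB, h.filter_opener hB, Finset.prod_singleton]

end IsPartitionOf

theorem sum_prod_card_le (A : Set ℕ) (n : ℕ) {ω : ℕ → ℝ} (h0 : ω 0 = 1) (hω : ∀ j, 0 ≤ ω j) :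
    ∑ P ∈ NCPA A n, ∏ B ∈ P, ω B.card ≤
      (∑ j ∈ insert 0 ((Finset.Icc 1 n).filter (· ∈ A)), ω j) ^ n := by
  set t := insert 0 ((Finset.Icc 1 n).filter (· ∈ A)) with ht
  have hword : ∀ P ∈ NCPA A n,
      ∏ B ∈ P, ω B.card = ∏ i : Fin n, ω (openerSize P (i + 1)) := by
    intro P hP
    rw [← (mem_NCPA_iff.1 hP).1.prod_openerSize h0,
      ← Finset.prod_range (fun i => ω (openerSize P (i + 1))),
      Finset.range_eq_Ico, Finset.prod_Ico_add' (fun i => ω (openerSize P i)) 0 n 1]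
    rfl
  rw [Finset.sum_congr rfl hword, Finset.sum_pow']
  rw [← Finset.sum_image (f := fun p : Fin n → ℕ => ∏ i : Fin n, ω (p i))
    (g := fun (P : Finset (Finset ℕ)) (i : Fin n) => openerSize P (i + 1))]
  · refine Finset.sum_le_sum_of_subset_of_nonneg ?_ fun _ _ _ => Finset.prod_nonneg fun _ _ => hω _
    intro p hp
    obtain ⟨P, hP, rfl⟩ := Finset.mem_image.1 hp
    obtain ⟨h1, -, h3⟩ := mem_NCPA_iff.1 hP
    refine Fintype.mem_piFinset.2 fun i => ?_
    rcases IsPartitionOf.eq_zero_or_exists P (i + 1) with hi | ⟨B, hB, hi⟩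
    · simp [openerSize, hi, ht]
    · rw [← hi, h1.openerSize_opener hB, ht]
      refine Finset.mem_insert_of_mem (Finset.mem_filter.2 ⟨Finset.mem_Icc.2 ⟨?_, ?_⟩, h3 B hB⟩)
      · exact (h1.1 B hB).2.card_pos
      · simpa using Finset.card_le_card (h1.1 B hB).1
  · intro P hP Q hQ hPQ
    obtain ⟨h1, h2, -⟩ := mem_NCPA_iff.1 hP
    obtain ⟨h1', h2', -⟩ := mem_NCPA_iff.1 hQ
    refine h1.eq_of_openerSize_eq h1' h2 h2' fun i hi => ?_
    obtain ⟨hi1, hin⟩ := Finset.mem_Icc.1 hi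
    have := congrFun hPQ ⟨i - 1, by omega⟩
    simpa [Nat.sub_add_cancel hi1] using this

/-- The partition `P` of `[l]` followed by a copy of `Q` translated by `l`. -/
noncomputable def concat (l : ℕ) (P Q : Finset (Finset ℕ)) : Finset (Finset ℕ) :=
  P ∪ Q.map (Finset.mapEmbedding (addRightEmbedding l)).toEmbedding

theorem mem_concat {l : ℕ} {P Q : Finset (Finset ℕ)} {B : Finset ℕ} :
    B ∈ concat l P Q ↔ B ∈ P ∨ ∃ C ∈ Q, C.map (addRightEmbedding l) = B := by
  simp [concat]

theorem mem_map_add {l x : ℕ} {C : Finset ℕ} :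
    x ∈ C.map (addRightEmbedding l) ↔ ∃ c ∈ C, c + l = x := by
  simp

theorem isPartitionOf_concat {l m : ℕ} {P Q : Finset (Finset ℕ)} (hP : IsPartitionOf l P)
    (hQ : IsPartitionOf m Q) : IsPartitionOf (l + m) (concat l P Q) := by
  refine ⟨fun B hB => ?_, fun x hx => ?_⟩
  · rcases mem_concat.1 hB with hB | ⟨C, hC, rfl⟩
    · exact ⟨(hP.1 B hB).1.trans (Finset.Icc_subset_Icc le_rfl (Nat.le_add_right _ _)),
        (hP.1 B hB).2⟩
    · refine ⟨fun x hx => ?_, (hQ.1 C hC).2.map⟩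
      obtain ⟨c, hc, rfl⟩ := mem_map_add.1 hx
      have h1 := hQ.pos_of_mem hC hc
      have h2 := hQ.le_of_mem hC hc
      exact Finset.mem_Icc.2 ⟨by omega, by omega⟩
  · obtain ⟨hx1, hx2⟩ := Finset.mem_Icc.1 hx
    by_cases hxl : x ≤ l
    · obtain ⟨B, hB, hxB⟩ := hP.exists_mem hx1 hxl
      refine ⟨B, ⟨mem_concat.2 (Or.inl hB), hxB⟩, fun B' ⟨hB', hxB'⟩ => ?_⟩
      rcases mem_concat.1 hB' with hB' | ⟨C, hC, rfl⟩
      · exact hP.eq_of_mem hB' hB hxB' hxB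
      · obtain ⟨c, hc, rfl⟩ := mem_map_add.1 hxB'
        have := hQ.pos_of_mem hC hc
        omega
    · obtain ⟨C, hC, hxC⟩ := hQ.exists_mem (x := x - l) (by omega) (by omega)
      refine ⟨C.map (addRightEmbedding l), ⟨mem_concat.2 (Or.inr ⟨C, hC, rfl⟩),
        mem_map_add.2 ⟨_, hxC, by omega⟩⟩, fun B' ⟨hB', hxB'⟩ => ?_⟩
      rcases mem_concat.1 hB' with hB' | ⟨C', hC', rfl⟩
      · have := hP.le_of_mem hB' hxB'
        omega
      · obtain ⟨c, hc, hcx⟩ := mem_map_add.1 hxB'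
        have : c = x - l := by omega
        rw [hQ.eq_of_mem hC' hC hc (this ▸ hxC)]

theorem isNonCrossing_concat {l : ℕ} {P Q : Finset (Finset ℕ)} (hP : IsPartitionOf l P)
    (hPc : IsNonCrossing P) (hQc : IsNonCrossing Q) :
    IsNonCrossing (concat l P Q) := by
  intro B hB B' hB' hne a b c d hab hbc hcd ha hc hb hd
  rcases mem_concat.1 hB with hB | ⟨C, hC, rfl⟩ <;>
    rcases mem_concat.1 hB' with hB' | ⟨C', hC', rfl⟩
  · exact hPc B hB B' hB' hne a b c d hab hbc hcd ha hc hb hd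
  · obtain ⟨b', hb', rfl⟩ := mem_map_add.1 hb
    have := hP.le_of_mem hB hc
    omega
  · obtain ⟨a', ha', rfl⟩ := mem_map_add.1 ha
    have := hP.le_of_mem hB' hb
    omega
  · obtain ⟨a', ha', rfl⟩ := mem_map_add.1 ha
    obtain ⟨b', hb', rfl⟩ := mem_map_add.1 hb
    obtain ⟨c', hc', rfl⟩ := mem_map_add.1 hc
    obtain ⟨d', hd', rfl⟩ := mem_map_add.1 hd
    exact hQc C hC C' hC' (fun h => hne (h ▸ rfl)) a' b' c' d' (by omega) (by omega) (by omega)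
      ha' hc' hb' hd'

theorem subset_of_concat_eq {l m m' : ℕ} {P Q P' Q' : Finset (Finset ℕ)} (hP : IsPartitionOf l P)
    (hQ : IsPartitionOf m Q) (hP' : IsPartitionOf l P') (hQ' : IsPartitionOf m' Q')
    (h : concat l P Q = concat l P' Q') : P ⊆ P' ∧ Q ⊆ Q' := by
  refine ⟨fun B hB => ?_, fun C hC => ?_⟩
  · have hB' : B ∈ concat l P' Q' := h ▸ mem_concat.2 (Or.inl hB)
    rcases mem_concat.1 hB' with hB' | ⟨C, hC, rfl⟩
    · exact hB'
    · obtain ⟨c, hc⟩ := (hQ'.1 C hC).2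
      have h1 := hQ'.pos_of_mem hC hc
      have h2 := hP.le_of_mem hB (mem_map_add.2 ⟨c, hc, rfl⟩)
      omega
  · have hC' : C.map (addRightEmbedding l) ∈ concat l P' Q' :=
      h ▸ mem_concat.2 (Or.inr ⟨C, hC, rfl⟩)
    rcases mem_concat.1 hC' with hC' | ⟨C', hC', hCC'⟩
    · obtain ⟨c, hc⟩ := (hQ.1 C hC).2
      have h1 := hQ.pos_of_mem hC hc
      have h2 := hP'.le_of_mem hC' (mem_map_add.2 ⟨c, hc, rfl⟩)
      omega
    · exact Finset.map_injective _ hCC' ▸ hC'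

theorem concat_inj {l m m' : ℕ} {P Q P' Q' : Finset (Finset ℕ)} (hP : IsPartitionOf l P)
    (hQ : IsPartitionOf m Q) (hP' : IsPartitionOf l P') (hQ' : IsPartitionOf m' Q')
    (h : concat l P Q = concat l P' Q') : P = P' ∧ Q = Q' := by
  have h1 := subset_of_concat_eq hP hQ hP' hQ' h
  have h2 := subset_of_concat_eq hP' hQ' hP hQ h.symm
  exact ⟨h1.1.antisymm h2.1, h1.2.antisymm h2.2⟩

theorem concat_mem_NCPA {A : Set ℕ} {l m : ℕ} {P Q : Finset (Finset ℕ)} (hP : P ∈ NCPA A l)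
    (hQ : Q ∈ NCPA A m) : concat l P Q ∈ NCPA A (l + m) := by
  obtain ⟨h1, h2, h3⟩ := mem_NCPA_iff.1 hP
  obtain ⟨h1', h2', h3'⟩ := mem_NCPA_iff.1 hQ
  refine mem_NCPA_iff.2 ⟨isPartitionOf_concat h1 h1', isNonCrossing_concat h1 h2 h2', ?_⟩
  intro B hB
  rcases mem_concat.1 hB with hB | ⟨C, hC, rfl⟩
  · exact h3 B hB
  · simpa using h3' C hC

theorem card_NCPA_mul_le (A : Set ℕ) (l m : ℕ) :
    (NCPA A l).card * (NCPA A m).card ≤ (NCPA A (l + m)).card := by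
  rw [← Finset.card_product]
  refine Finset.card_le_card_of_injOn (fun x => concat l x.1 x.2) (fun x hx => ?_) ?_
  · exact concat_mem_NCPA (Finset.mem_product.1 hx).1 (Finset.mem_product.1 hx).2
  · rintro ⟨P, Q⟩ hx ⟨P', Q'⟩ hy h
    obtain ⟨hP, hQ⟩ := Finset.mem_product.1 hx
    obtain ⟨hP', hQ'⟩ := Finset.mem_product.1 hy
    obtain ⟨rfl, rfl⟩ := concat_inj (mem_NCPA_iff.1 hP).1 (mem_NCPA_iff.1 hQ).1
      (mem_NCPA_iff.1 hP').1 (mem_NCPA_iff.1 hQ').1 h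
    rfl

theorem isPartitionOf_zero {P : Finset (Finset ℕ)} : IsPartitionOf 0 P ↔ P = ∅ := by
  constructor
  · intro h
    refine Finset.eq_empty_of_forall_notMem fun B hB => ?_
    obtain ⟨x, hx⟩ := (h.1 B hB).2
    have h1 := h.pos_of_mem hB hx
    have h2 := h.le_of_mem hB hx
    omega
  · rintro rfl
    exact ⟨by simp, by simp⟩

/-- The block containing `1`, or `∅` if there is none. -/
noncomputable def root (P : Finset (Finset ℕ)) : Finset ℕ := (P.filter (1 ∈ ·)).biUnion id

theorem root_empty : root ∅ = ∅ := by simp [root]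

namespace IsPartitionOf

variable {n : ℕ} {P : Finset (Finset ℕ)}

theorem root_eq (h : IsPartitionOf n P) {B : Finset ℕ} (hB : B ∈ P) (h1 : 1 ∈ B) :
    root P = B := by
  have : P.filter (1 ∈ ·) = {B} := by
    ext C
    simp only [Finset.mem_filter, Finset.mem_singleton]
    exact ⟨fun hC => h.eq_of_mem hC.1 hB hC.2 h1, fun hC => by subst hC; exact ⟨hB, h1⟩⟩
  rw [root, this, Finset.singleton_biUnion, id]

theorem root_mem (h : IsPartitionOf n P) (hn : 1 ≤ n) : root P ∈ P ∧ 1 ∈ root P := by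
  obtain ⟨B, hB, h1⟩ := h.exists_mem le_rfl hn
  rw [h.root_eq hB h1]
  exact ⟨hB, h1⟩

theorem root_subset (h : IsPartitionOf n P) : root P ⊆ Finset.Icc 1 n := by
  intro x hx
  obtain ⟨B, hB, hxB⟩ := Finset.mem_biUnion.1 hx
  exact (h.1 B (Finset.mem_filter.1 hB).1).1 hxB

theorem notMem_root (h : IsPartitionOf n P) : n + 1 ∉ root P := fun hx => by
  have := (Finset.mem_Icc.1 (h.root_subset hx)).2
  omega

end IsPartitionOf

/-- The element `l + 1` is added to the block of `1` of the partition `P` of `[l]`. -/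
noncomputable def addRoot (l : ℕ) (P : Finset (Finset ℕ)) : Finset (Finset ℕ) :=
  insert (insert (l + 1) (root P)) (P.erase (root P))

theorem mem_addRoot {l : ℕ} {P : Finset (Finset ℕ)} {B : Finset ℕ} :
    B ∈ addRoot l P ↔ B = insert (l + 1) (root P) ∨ B ≠ root P ∧ B ∈ P := by
  simp [addRoot]

theorem isPartitionOf_addRoot {l : ℕ} {P : Finset (Finset ℕ)} (hP : IsPartitionOf l P) :
    IsPartitionOf (l + 1) (addRoot l P) := by
  have hsub : Finset.Icc 1 l ⊆ Finset.Icc 1 (l + 1) :=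
    Finset.Icc_subset_Icc le_rfl (Nat.le_succ _)
  refine ⟨fun B hB => ?_, fun x hx => ?_⟩
  · rcases mem_addRoot.1 hB with rfl | ⟨-, hB⟩
    · refine ⟨Finset.insert_subset ?_ (hP.root_subset.trans hsub), Finset.insert_nonempty _ _⟩
      exact Finset.mem_Icc.2 ⟨by omega, le_rfl⟩
    · exact ⟨(hP.1 B hB).1.trans hsub, (hP.1 B hB).2⟩
  · obtain ⟨hx1, hx2⟩ := Finset.mem_Icc.1 hx
    by_cases hxr : x ∈ insert (l + 1) (root P)
    · refine ⟨_, ⟨mem_addRoot.2 (Or.inl rfl), hxr⟩, fun B ⟨hB, hxB⟩ => ?_⟩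
      rcases mem_addRoot.1 hB with rfl | ⟨hne, hB⟩
      · rfl
      · have hxl := hP.le_of_mem hB hxB
        rcases Finset.mem_insert.1 hxr with h | h
        · omega
        · exact absurd (hP.eq_of_mem hB (hP.root_mem (hx1.trans hxl)).1 hxB h) hne
    · have hxl : x ≤ l := by
        have : x ≠ l + 1 := fun h => hxr (h ▸ Finset.mem_insert_self _ _)
        omega
      obtain ⟨B, hB, hxB⟩ := hP.exists_mem hx1 hxl
      refine ⟨B, ⟨mem_addRoot.2 (Or.inr ⟨?_, hB⟩), hxB⟩, fun B' ⟨hB', hxB'⟩ => ?_⟩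
      · rintro rfl
        exact hxr (Finset.mem_insert_of_mem hxB)
      · rcases mem_addRoot.1 hB' with rfl | ⟨-, hB'⟩
        · exact absurd hxB' hxr
        · exact hP.eq_of_mem hB' hB hxB' hxB

theorem isNonCrossing_addRoot {l : ℕ} {P : Finset (Finset ℕ)} (hP : IsPartitionOf l P)
    (hPc : IsNonCrossing P) : IsNonCrossing (addRoot l P) := by
  intro B hB B' hB' hne a b c d hab hbc hcd ha hc hb hd
  rcases mem_addRoot.1 hB with rfl | ⟨hBr, hB⟩ <;>
    rcases mem_addRoot.1 hB' with rfl | ⟨hBr', hB'⟩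
  · exact hne rfl
  · have hdl := hP.le_of_mem hB' hd
    have hr := hP.root_mem (by omega)
    have ha' := Finset.mem_of_mem_insert_of_ne ha (by omega)
    have hc' := Finset.mem_of_mem_insert_of_ne hc (by omega)
    exact hPc _ hr.1 B' hB' hBr'.symm a b c d hab hbc hcd ha' hc' hb hd
  · have hcl := hP.le_of_mem hB hc
    have hr := hP.root_mem (by omega)
    have hb' := Finset.mem_of_mem_insert_of_ne hb (by omega)
    have ha1 : 1 < a := by
      refine lt_of_le_of_ne (hP.pos_of_mem hB ha) ?_
      rintro rfl
      exact hBr (hP.eq_of_mem hB hr.1 ha hr.2)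
    exact hPc _ hr.1 B hB hBr.symm 1 a b c ha1 hab hbc hr.2 hb' ha hc
  · exact hPc B hB B' hB' hne a b c d hab hbc hcd ha hc hb hd

theorem root_addRoot {l : ℕ} {P : Finset (Finset ℕ)} (hP : IsPartitionOf l P) :
    root (addRoot l P) = insert (l + 1) (root P) := by
  refine (isPartitionOf_addRoot hP).root_eq (mem_addRoot.2 (Or.inl rfl)) ?_
  rcases Nat.eq_zero_or_pos l with rfl | hl
  · exact Finset.mem_insert_self _ _
  · exact Finset.mem_insert_of_mem (hP.root_mem hl).2

theorem root_concat {l m : ℕ} {P Q : Finset (Finset ℕ)} (hP : IsPartitionOf l P)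
    (hQ : IsPartitionOf m Q) (hl : 1 ≤ l) : root (concat l P Q) = root P :=
  (isPartitionOf_concat hP hQ).root_eq (mem_concat.2 (Or.inl (hP.root_mem hl).1))
    (hP.root_mem hl).2

theorem subset_of_addRoot_eq {l : ℕ} {P P' : Finset (Finset ℕ)} (hP : IsPartitionOf l P)
    (hP' : IsPartitionOf l P') (h : addRoot l P = addRoot l P') : P ⊆ P' := by
  intro C hC
  by_cases hCr : C = root P
  · have hr := congrArg (fun R => (root R).erase (l + 1)) h
    simp only [root_addRoot hP, root_addRoot hP', Finset.erase_insert hP.notMem_root,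
      Finset.erase_insert hP'.notMem_root] at hr
    obtain ⟨x, hx⟩ := (hP.1 C hC).2
    rw [hCr, hr]
    exact (hP'.root_mem ((hP.pos_of_mem hC hx).trans (hP.le_of_mem hC hx))).1
  · have hC' : C ∈ addRoot l P' := h ▸ mem_addRoot.2 (Or.inr ⟨hCr, hC⟩)
    rcases mem_addRoot.1 hC' with rfl | ⟨-, hC'⟩
    · have := hP.le_of_mem hC (Finset.mem_insert_self _ _)
      omega
    · exact hC'

/-- Non-crossing partitions of `[n]` in which the block of `1` has size `k` and the other blocks
have sizes in `A`. -/
noncomputable def rootedNCP (A : Set ℕ) (k n : ℕ) : Finset (Finset (Finset ℕ)) :=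
  (NCPA Set.univ n).filter fun P => (root P).card = k ∧ ∀ C ∈ P, C ≠ root P → C.card ∈ A

theorem mem_rootedNCP_iff {A : Set ℕ} {k n : ℕ} {P : Finset (Finset ℕ)} :
    P ∈ rootedNCP A k n ↔ IsPartitionOf n P ∧ IsNonCrossing P ∧ (root P).card = k ∧
      ∀ C ∈ P, C ≠ root P → C.card ∈ A := by
  simp [rootedNCP, mem_NCPA_iff, and_assoc]

theorem concat_addRoot_mem {A : Set ℕ} {k l m : ℕ} {P Q : Finset (Finset ℕ)}
    (hP : P ∈ rootedNCP A k l) (hQ : Q ∈ NCPA A m) :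
    concat (l + 1) (addRoot l P) Q ∈ rootedNCP A (k + 1) (l + 1 + m) := by
  obtain ⟨h1, h2, h3, h4⟩ := mem_rootedNCP_iff.1 hP
  obtain ⟨h1', h2', h3'⟩ := mem_NCPA_iff.1 hQ
  have ha := isPartitionOf_addRoot h1
  have hr := root_concat ha h1' (by omega)
  refine mem_rootedNCP_iff.2 ⟨isPartitionOf_concat ha h1',
    isNonCrossing_concat ha (isNonCrossing_addRoot h1 h2) h2', ?_, fun C hC hne => ?_⟩
  · rw [hr, root_addRoot h1, Finset.card_insert_of_notMem h1.notMem_root, h3]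
  · rw [hr, root_addRoot h1] at hne
    rcases mem_concat.1 hC with hC | ⟨D, hD, rfl⟩
    · rcases mem_addRoot.1 hC with rfl | ⟨hCr, hC⟩
      · exact absurd rfl hne
      · exact h4 C hC hCr
    · simpa using h3' D hD

theorem le_of_root_concat_addRoot_eq {l m l' m' : ℕ} {P Q P' Q' : Finset (Finset ℕ)}
    (hP : IsPartitionOf l P) (hQ : IsPartitionOf m Q) (hP' : IsPartitionOf l' P')
    (hQ' : IsPartitionOf m' Q')
    (h : concat (l + 1) (addRoot l P) Q = concat (l' + 1) (addRoot l' P') Q') : l ≤ l' := by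
  have hr := congrArg root h
  rw [root_concat (isPartitionOf_addRoot hP) hQ (by omega), root_addRoot hP,
    root_concat (isPartitionOf_addRoot hP') hQ' (by omega), root_addRoot hP'] at hr
  have hmem : l + 1 ∈ insert (l' + 1) (root P') := hr ▸ Finset.mem_insert_self _ _
  rcases Finset.mem_insert.1 hmem with h | h
  · omega
  · have := (Finset.mem_Icc.1 (hP'.root_subset h)).2
    omega

theorem sum_card_rootedNCP_mul_le (A : Set ℕ) (k n : ℕ) :
    ∑ p ∈ Finset.HasAntidiagonal.antidiagonal n, (rootedNCP A k p.1).card * (NCPA A p.2).card ≤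
      (rootedNCP A (k + 1) (n + 1)).card := by
  simp_rw [← Finset.card_product]
  rw [← Finset.card_sigma]
  refine Finset.card_le_card_of_injOn
    (fun x => concat (x.1.1 + 1) (addRoot x.1.1 x.2.1) x.2.2) ?_ ?_
  · rintro ⟨⟨l, m⟩, P, Q⟩ hx
    simp only [Finset.coe_sigma, Set.mem_sigma_iff, Finset.mem_coe, Finset.HasAntidiagonal.mem_antidiagonal,
      Finset.mem_product] at hx
    obtain ⟨rfl, hP, hQ⟩ := hx
    have := concat_addRoot_mem hP hQ
    rwa [add_right_comm] at this
  · rintro ⟨⟨l, m⟩, P, Q⟩ hx ⟨⟨l', m'⟩, P', Q'⟩ hx' h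
    simp only [Finset.coe_sigma, Set.mem_sigma_iff, Finset.mem_coe, Finset.HasAntidiagonal.mem_antidiagonal,
      Finset.mem_product] at hx hx' h
    obtain ⟨hlm, hP, hQ⟩ := hx
    obtain ⟨hlm', hP', hQ'⟩ := hx'
    replace hP := (mem_rootedNCP_iff.1 hP).1
    replace hP' := (mem_rootedNCP_iff.1 hP').1
    replace hQ := (mem_NCPA_iff.1 hQ).1
    replace hQ' := (mem_NCPA_iff.1 hQ').1
    obtain rfl := (le_of_root_concat_addRoot_eq hP hQ hP' hQ' h).antisymm
      (le_of_root_concat_addRoot_eq hP' hQ' hP hQ h.symm)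
    obtain rfl : m = m' := by omega
    obtain ⟨hPP', rfl⟩ := concat_inj (isPartitionOf_addRoot hP) hQ (isPartitionOf_addRoot hP') hQ' h
    obtain rfl := (subset_of_addRoot_eq hP hP' hPP').antisymm (subset_of_addRoot_eq hP' hP hPP'.symm)
    rfl

theorem one_le_card_rootedNCP_zero (A : Set ℕ) : 1 ≤ (rootedNCP A 0 0).card := by
  refine Finset.card_pos.2 ⟨∅, mem_rootedNCP_iff.2 ⟨isPartitionOf_zero.2 rfl, ?_, ?_, ?_⟩⟩
  · simp [IsNonCrossing]
  · simp [root_empty]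
  · simp

theorem rootedNCP_subset {A : Set ℕ} {k n : ℕ} (hk : k = 0 ∨ k ∈ A) :
    rootedNCP A k n ⊆ NCPA A n := by
  intro P hP
  obtain ⟨h1, h2, h3, h4⟩ := mem_rootedNCP_iff.1 hP
  refine mem_NCPA_iff.2 ⟨h1, h2, fun B hB => ?_⟩
  by_cases hBr : B = root P
  · rcases hk with rfl | hk
    · exact absurd (Finset.card_eq_zero.1 h3) (hBr ▸ (h1.1 B hB).2.ne_empty)
    · rwa [hBr, h3]
  · exact h4 B hB hBr

theorem sum_card_rootedNCP_le {A : Set ℕ} {s : Finset ℕ} (hs : ∀ k ∈ s, k = 0 ∨ k ∈ A) (n : ℕ) :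
    ∑ k ∈ s, (rootedNCP A k n).card ≤ (NCPA A n).card := by
  rw [← Finset.card_biUnion]
  · exact Finset.card_le_card (Finset.biUnion_subset.2 fun k hk => rootedNCP_subset (hs k hk))
  · intro k _ k' _ hne
    refine Finset.disjoint_left.2 fun P hP hP' => hne ?_
    exact (mem_rootedNCP_iff.1 hP).2.2.1.symm.trans (mem_rootedNCP_iff.1 hP').2.2.1

/-- The cyclic shift `1 ↦ 2 ↦ ⋯ ↦ n ↦ 1`, extended by the identity to `ℕ`. -/
def cyclicShift (n : ℕ) : ℕ ≃ ℕ where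
  toFun x := if x = 0 ∨ n < x then x else if x = n then 1 else x + 1
  invFun x := if x = 0 ∨ n < x then x else if x = 1 then n else x - 1
  left_inv x := by grind
  right_inv x := by grind

theorem cyclicShift_of_lt {n x : ℕ} (h1 : 1 ≤ x) (hn : x < n) : cyclicShift n x = x + 1 := by
  simp only [cyclicShift, Equiv.coe_fn_mk]
  split_ifs <;> omega

theorem cyclicShift_self {n : ℕ} (h1 : 1 ≤ n) : cyclicShift n n = 1 := by
  simp only [cyclicShift, Equiv.coe_fn_mk]
  split_ifs <;> omega

theorem cyclicShift_mem_Icc {n x : ℕ} : cyclicShift n x ∈ Finset.Icc 1 n ↔ x ∈ Finset.Icc 1 n := by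
  simp only [cyclicShift, Equiv.coe_fn_mk, Finset.mem_Icc]
  split_ifs <;> omega

/-- The image of a partition of `[n]` under the cyclic shift. -/
def rotate (n : ℕ) (P : Finset (Finset ℕ)) : Finset (Finset ℕ) :=
  P.map (Finset.mapEmbedding (cyclicShift n).toEmbedding).toEmbedding

theorem mem_rotate {n : ℕ} {P : Finset (Finset ℕ)} {B : Finset ℕ} :
    B ∈ rotate n P ↔ ∃ C ∈ P, C.map (cyclicShift n).toEmbedding = B := by
  simp [rotate]

theorem isPartitionOf_rotate {n : ℕ} {P : Finset (Finset ℕ)} (hP : IsPartitionOf n P) :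
    IsPartitionOf n (rotate n P) := by
  refine ⟨fun B hB => ?_, fun x hx => ?_⟩
  · obtain ⟨C, hC, rfl⟩ := mem_rotate.1 hB
    refine ⟨fun x hx => ?_, (hP.1 C hC).2.map⟩
    obtain ⟨c, hc, rfl⟩ := Finset.mem_map.1 hx
    exact cyclicShift_mem_Icc.2 ((hP.1 C hC).1 hc)
  · obtain ⟨y, rfl⟩ := (cyclicShift n).surjective x
    obtain ⟨B, ⟨hB, hyB⟩, huniq⟩ := hP.2 y (cyclicShift_mem_Icc.1 hx)
    refine ⟨_, ⟨mem_rotate.2 ⟨B, hB, rfl⟩, Finset.mem_map_of_mem _ hyB⟩, fun B' ⟨hB', hxB'⟩ => ?_⟩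
    obtain ⟨C, hC, rfl⟩ := mem_rotate.1 hB'
    rw [huniq C ⟨hC, (Finset.mem_map' (cyclicShift n).toEmbedding).1 hxB'⟩]

theorem isNonCrossing_rotate {n : ℕ} {P : Finset (Finset ℕ)} (hP : IsPartitionOf n P)
    (hPc : IsNonCrossing P) : IsNonCrossing (rotate n P) := by
  intro B hB B' hB' hne a b c d hab hbc hcd ha hc hb hd
  obtain ⟨C, hC, rfl⟩ := mem_rotate.1 hB
  obtain ⟨C', hC', rfl⟩ := mem_rotate.1 hB'
  replace hne : C ≠ C' := fun h => hne (h ▸ rfl)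
  obtain ⟨a, ha₀, rfl⟩ := Finset.mem_map.1 ha
  obtain ⟨b, hb₀, rfl⟩ := Finset.mem_map.1 hb
  obtain ⟨c, hc₀, rfl⟩ := Finset.mem_map.1 hc
  obtain ⟨d, hd₀, rfl⟩ := Finset.mem_map.1 hd
  have hrot : ∀ {D : Finset ℕ}, D ∈ P → ∀ {x : ℕ}, x ∈ D →
      1 ≤ x ∧ (x < n ∧ cyclicShift n x = x + 1 ∨ x = n ∧ cyclicShift n x = 1) := by
    intro D hD x hx
    have h1 := hP.pos_of_mem hD hx
    rcases (hP.le_of_mem hD hx).lt_or_eq with h | rfl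
    · exact ⟨h1, Or.inl ⟨h, cyclicShift_of_lt h1 h⟩⟩
    · exact ⟨h1, Or.inr ⟨rfl, cyclicShift_self h1⟩⟩
  have ha' := hrot hC ha₀
  have hb' := hrot hC' hb₀
  have hc' := hrot hC hc₀
  have hd' := hrot hC' hd₀
  simp only [Equiv.coe_toEmbedding] at hab hbc hcd
  by_cases han : a = n
  · exact hPc C' hC' C hC hne.symm b c d a (by omega) (by omega) (by omega) hb₀ hd₀ hc₀ ha₀
  · exact hPc C hC C' hC' hne a b c d (by omega) (by omega) (by omega) ha₀ hc₀ hb₀ hd₀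

/-- Partitions in `NCPA A n` in which the block of `x` has size `k`. -/
noncomputable def blockSizeNCP (A : Set ℕ) (k n x : ℕ) : Finset (Finset (Finset ℕ)) :=
  (NCPA A n).filter fun P => ∃ B ∈ P, x ∈ B ∧ B.card = k

theorem card_blockSizeNCP_le (A : Set ℕ) (k n x : ℕ) :
    (blockSizeNCP A k n x).card ≤ (blockSizeNCP A k n (cyclicShift n x)).card := by
  refine Finset.card_le_card_of_injOn (rotate n) (fun P hP => ?_)
    ((Finset.map_injective _).injOn)
  obtain ⟨hP, B, hB, hxB, hBk⟩ := Finset.mem_filter.1 hP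
  obtain ⟨h1, h2, h3⟩ := mem_NCPA_iff.1 hP
  refine Finset.mem_filter.2 ⟨mem_NCPA_iff.2 ⟨isPartitionOf_rotate h1,
    isNonCrossing_rotate h1 h2, fun C hC => ?_⟩, _, mem_rotate.2 ⟨B, hB, rfl⟩,
    Finset.mem_map_of_mem _ hxB, by rwa [Finset.card_map]⟩
  obtain ⟨D, hD, rfl⟩ := mem_rotate.1 hC
  rw [Finset.card_map]
  exact h3 D hD

theorem card_blockSizeNCP_eq (A : Set ℕ) (k : ℕ) {n x : ℕ} (h1 : 1 ≤ x) (hn : x ≤ n) :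
    (blockSizeNCP A k n x).card = (blockSizeNCP A k n 1).card := by
  have hmono : ∀ y, 1 ≤ y → ∀ z, y ≤ z → z ≤ n →
      (blockSizeNCP A k n y).card ≤ (blockSizeNCP A k n z).card := by
    intro y hy z hyz
    induction z, hyz using Nat.le_induction with
    | base => exact fun _ => le_rfl
    | succ z hyz ih =>
      intro hzn
      refine (ih (by omega)).trans ((card_blockSizeNCP_le A k n z).trans_eq ?_)
      rw [cyclicShift_of_lt (by omega) (by omega)]
  refine le_antisymm ((hmono x h1 n hn le_rfl).trans ?_) (hmono 1 le_rfl x h1 hn)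
  refine (card_blockSizeNCP_le A k n n).trans_eq ?_
  rw [cyclicShift_self (h1.trans hn)]

theorem mul_card_blockSizeNCP_one (A : Set ℕ) (k n : ℕ) :
    n * (blockSizeNCP A k n 1).card = k * ∑ P ∈ NCPA A n, (P.filter (·.card = k)).card := by
  have h : ∑ x ∈ Finset.Icc 1 n, (blockSizeNCP A k n x).card = n * (blockSizeNCP A k n 1).card := by
    rw [Finset.sum_congr rfl fun x hx => card_blockSizeNCP_eq A k (Finset.mem_Icc.1 hx).1
      (Finset.mem_Icc.1 hx).2]
    simp
  rw [← h]
  simp only [blockSizeNCP, Finset.card_filter _ (NCPA A n)]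
  rw [Finset.sum_comm, Finset.mul_sum]
  refine Finset.sum_congr rfl fun P hP => ?_
  rw [← Finset.card_filter]
  have hpart := (mem_NCPA_iff.1 hP).1
  have hU : (Finset.Icc 1 n).filter (fun x => ∃ B ∈ P, x ∈ B ∧ B.card = k) =
      (P.filter (·.card = k)).biUnion id := by
    ext x
    simp only [Finset.mem_filter, Finset.mem_biUnion, id]
    constructor
    · rintro ⟨-, B, hB, hx, hk⟩
      exact ⟨B, ⟨hB, hk⟩, hx⟩
    · rintro ⟨B, ⟨hB, hk⟩, hx⟩
      exact ⟨(hpart.1 B hB).1 hx, B, hB, hx, hk⟩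
  rw [hU, Finset.card_biUnion
    (hpart.pairwiseDisjoint.subset (Finset.coe_subset.2 (Finset.filter_subset _ _)))]
  exact (Finset.sum_const_nat fun B hB => (Finset.mem_filter.1 hB).2).trans (mul_comm _ _)

open scoped ENNReal in
theorem ennreal_tsum_mul_tsum_eq_tsum_antidiagonal (f g : ℕ → ℝ≥0∞) :
    (∑' n, f n) * ∑' n, g n =
      ∑' n, ∑ p ∈ Finset.HasAntidiagonal.antidiagonal n, f p.1 * g p.2 := by
  simp_rw [← ENNReal.tsum_mul_right, ← ENNReal.tsum_mul_left]
  rw [← ENNReal.tsum_prod (f := fun a b => f a * g b),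
    ← Finset.HasAntidiagonal.sigmaAntidiagonalEquivProd.tsum_eq (fun p : ℕ × ℕ => f p.1 * g p.2),
    ENNReal.tsum_sigma']
  refine tsum_congr fun n => ?_
  rw [tsum_fintype]
  exact Finset.sum_finset_coe (fun p : ℕ × ℕ => f p.1 * g p.2) _

open scoped ENNReal in
theorem pow_le_tsum_rootedNCP (A : Set ℕ) (z : ℝ≥0∞) (k : ℕ) :
    (z * ∑' n, ((NCPA A n).card : ℝ≥0∞) * z ^ n) ^ k ≤
      ∑' n, ((rootedNCP A k n).card : ℝ≥0∞) * z ^ n := by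
  induction k with
  | zero =>
    refine le_trans ?_ (ENNReal.le_tsum 0)
    simpa using one_le_card_rootedNCP_zero A
  | succ k ih =>
    rw [pow_succ, mul_left_comm]
    calc z * ((z * ∑' n, ((NCPA A n).card : ℝ≥0∞) * z ^ n) ^ k *
          ∑' n, ((NCPA A n).card : ℝ≥0∞) * z ^ n)
        ≤ z * ((∑' n, ((rootedNCP A k n).card : ℝ≥0∞) * z ^ n) *
          ∑' n, ((NCPA A n).card : ℝ≥0∞) * z ^ n) := by gcongr
      _ = ∑' n, ((∑ p ∈ Finset.HasAntidiagonal.antidiagonal n,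
            (rootedNCP A k p.1).card * (NCPA A p.2).card : ℕ) : ℝ≥0∞) * z ^ (n + 1) := by
        rw [ennreal_tsum_mul_tsum_eq_tsum_antidiagonal, ← ENNReal.tsum_mul_left]
        refine tsum_congr fun n => ?_
        push_cast
        rw [Finset.mul_sum, Finset.sum_mul]
        refine Finset.sum_congr rfl fun p hp => ?_
        rw [← Finset.HasAntidiagonal.mem_antidiagonal.1 hp]
        ring
      _ ≤ ∑' n, ((rootedNCP A (k + 1) (n + 1)).card : ℝ≥0∞) * z ^ (n + 1) := by
        refine ENNReal.tsum_le_tsum fun n => ?_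
        gcongr
        exact sum_card_rootedNCP_mul_le A k n
      _ ≤ _ := ENNReal.tsum_comp_le_tsum_of_injective (add_left_injective 1)
        fun n => ((rootedNCP A (k + 1) n).card : ℝ≥0∞) * z ^ n

open scoped ENNReal in
theorem sum_pow_le_tsum_NCPA {A : Set ℕ} {s : Finset ℕ} (hs : ∀ k ∈ s, k = 0 ∨ k ∈ A)
    (z : ℝ≥0∞) :
    ∑ k ∈ s, (z * ∑' n, ((NCPA A n).card : ℝ≥0∞) * z ^ n) ^ k ≤
      ∑' n, ((NCPA A n).card : ℝ≥0∞) * z ^ n := by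
  calc ∑ k ∈ s, (z * ∑' n, ((NCPA A n).card : ℝ≥0∞) * z ^ n) ^ k
      ≤ ∑ k ∈ s, ∑' n, ((rootedNCP A k n).card : ℝ≥0∞) * z ^ n :=
        Finset.sum_le_sum fun k _ => pow_le_tsum_rootedNCP A z k
    _ = ∑' n, ((∑ k ∈ s, (rootedNCP A k n).card : ℕ) : ℝ≥0∞) * z ^ n := by
        rw [← Summable.tsum_finsetSum fun _ _ => ENNReal.summable]
        refine tsum_congr fun n => ?_
        push_cast
        rw [Finset.sum_mul]
    _ ≤ _ := by
        refine ENNReal.tsum_le_tsum fun n => ?_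
        gcongr
        exact sum_card_rootedNCP_le hs n

/-- If the generating function of `NCPA A` converges at `z`, then the equation
`t = z (1 + ∑ t ^ i)` has a positive supersolution. -/
theorem exists_supersolution {A : Set ℕ} (hApos : ∀ a ∈ A, 1 ≤ a) {z : ℝ} (hz : 0 < z)
    (hsum : Summable fun n => ((NCPA A n).card : ℝ) * z ^ n) :
    ∃ t : ℝ, 0 < t ∧ (Summable fun i : A => t ^ (i : ℕ)) ∧ z * (1 + ∑' i : A, t ^ (i : ℕ)) ≤ t := by
  set c : ℝ := ∑' n, ((NCPA A n).card : ℝ) * z ^ n with hc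
  have hnn : ∀ n, 0 ≤ ((NCPA A n).card : ℝ) * z ^ n := fun n => by positivity
  have hc0 : 0 ≤ c := tsum_nonneg hnn
  have hcast : ∑' n, ((NCPA A n).card : ENNReal) * ENNReal.ofReal z ^ n = ENNReal.ofReal c := by
    rw [hc, ENNReal.ofReal_tsum_of_nonneg hnn hsum]
    refine tsum_congr fun n => ?_
    rw [ENNReal.ofReal_mul (by positivity), ENNReal.ofReal_pow hz.le, ENNReal.ofReal_natCast]
  have hfin : ∀ s : Finset ℕ, (∀ k ∈ s, k = 0 ∨ k ∈ A) → ∑ k ∈ s, (z * c) ^ k ≤ c := by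
    intro s hs
    have := sum_pow_le_tsum_NCPA hs (ENNReal.ofReal z)
    rw [hcast, ← ENNReal.ofReal_mul hz.le] at this
    simp_rw [← ENNReal.ofReal_pow (mul_nonneg hz.le hc0)] at this
    rwa [← ENNReal.ofReal_sum_of_nonneg fun _ _ => by positivity,
      ENNReal.ofReal_le_ofReal_iff hc0] at this
  have hA : ∀ s : Finset A, ∑ i ∈ s, (z * c) ^ (i : ℕ) ≤ c - 1 := by
    intro s
    have h0 : 0 ∉ s.map (Function.Embedding.subtype _) := by
      intro h
      obtain ⟨a, -, ha⟩ := Finset.mem_map.1 h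
      have := hApos a a.2
      simp only [Function.Embedding.coe_subtype] at ha
      omega
    have := hfin (insert 0 (s.map (Function.Embedding.subtype _))) fun k hk => by
      rcases Finset.mem_insert.1 hk with rfl | hk
      · exact Or.inl rfl
      · obtain ⟨a, -, rfl⟩ := Finset.mem_map.1 hk
        exact Or.inr a.2
    rw [Finset.sum_insert h0, Finset.sum_map, pow_zero] at this
    simp only [Function.Embedding.coe_subtype] at this
    linarith
  have hc1 : 1 ≤ c := by simpa using hA ∅
  have ht : 0 < z * c := by positivity
  have hpos : ∀ i : A, 0 ≤ (z * c) ^ (i : ℕ) := fun i => by positivity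
  refine ⟨z * c, ht, summable_of_sum_le hpos hA, ?_⟩
  have := Real.tsum_le_of_sum_le hpos hA
  gcongr
  linarith

theorem one_add_tsum_tangent_le {A : Set ℕ} {ξ t : ℝ} (hξ : 0 < ξ) (ht : 0 < t)
    (hξsum' : Summable fun i : A => ξ ^ (i : ℕ))
    (hξsum : Summable fun i : A => (i : ℝ) * ξ ^ (i : ℕ))
    (hξeq : 1 + ∑' i : A, ξ ^ (i : ℕ) = ∑' i : A, (i : ℝ) * ξ ^ (i : ℕ))
    (htsum : Summable fun i : A => t ^ (i : ℕ)) :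
    t * (1 + ∑' i : A, ξ ^ (i : ℕ)) ≤ ξ * (1 + ∑' i : A, t ^ (i : ℕ)) := by
  have hterm : ∀ i : A, ξ ^ (i : ℕ) + (t / ξ - 1) * ((i : ℝ) * ξ ^ (i : ℕ)) ≤ t ^ (i : ℕ) := by
    intro i
    have h := one_add_mul_le_pow (a := t / ξ - 1) (by linarith [div_pos ht hξ]) (i : ℕ)
    rw [add_sub_cancel, div_pow, le_div_iff₀ (by positivity)] at h
    linarith
  have h := (hξsum'.add (hξsum.mul_left (t / ξ - 1))).tsum_le_tsum hterm htsum
  rw [hξsum'.tsum_add (hξsum.mul_left _), tsum_mul_left, ← hξeq] at h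
  have h2 : t / ξ * (1 + ∑' i : A, ξ ^ (i : ℕ)) ≤ 1 + ∑' i : A, t ^ (i : ℕ) := by linarith
  rw [div_mul_eq_mul_div, div_le_iff₀ hξ] at h2
  linarith

theorem card_NCPA_zero_le (A : Set ℕ) : (NCPA A 0).card ≤ 1 :=
  Finset.card_le_one.2 fun P hP Q hQ => by
    rw [isPartitionOf_zero.1 (mem_NCPA_iff.1 hP).1, isPartitionOf_zero.1 (mem_NCPA_iff.1 hQ).1]

theorem pow_mul_card_NCPA_le (A : Set ℕ) (m n q : ℕ) :
    (NCPA A n).card * (NCPA A m).card ^ q ≤ (NCPA A (n + m * q)).card := by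
  induction q with
  | zero => simp
  | succ q ih =>
    calc (NCPA A n).card * (NCPA A m).card ^ (q + 1)
        = (NCPA A n).card * (NCPA A m).card ^ q * (NCPA A m).card := by ring
      _ ≤ (NCPA A (n + m * q)).card * (NCPA A m).card := by gcongr
      _ ≤ (NCPA A (n + m * q + m)).card := card_NCPA_mul_le A _ _
      _ = (NCPA A (n + m * (q + 1))).card := by rw [mul_add_one, add_assoc]

/-- Subexponential lower bound: if `1 ≤ #(NCPA A m) z ^ m` for one `m`, then `#(NCPA A n) z ^ n`
is bounded below along its support. -/
theorem exists_lower_bound {A : Set ℕ} {z : ℝ} (hz : 0 < z) {m : ℕ} (hm : 0 < m)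
    (h1 : 1 ≤ ((NCPA A m).card : ℝ) * z ^ m) :
    ∃ δ : ℝ, 0 < δ ∧ ∀ n, (NCPA A n).Nonempty → δ ≤ ((NCPA A n).card : ℝ) * z ^ n := by
  have hres : ∀ r : ℕ, ∃ δ : ℝ, 0 < δ ∧
      ∀ n, n % m = r → (NCPA A n).Nonempty → δ ≤ ((NCPA A n).card : ℝ) * z ^ n := by
    intro r
    by_cases hr : ∃ n, n % m = r ∧ (NCPA A n).Nonempty
    · obtain ⟨hn₀, hne⟩ := Nat.find_spec hr
      set n₀ := Nat.find hr with hn₀_def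
      have hpos : (0 : ℝ) < (NCPA A n₀).card := by exact_mod_cast hne.card_pos
      refine ⟨(NCPA A n₀).card * z ^ n₀, by positivity, fun n hn hnne => ?_⟩
      have hle : n₀ ≤ n := Nat.find_min' hr ⟨hn, hnne⟩
      obtain ⟨q, hq⟩ := (Nat.modEq_iff_dvd' hle).1 (hn₀.trans hn.symm)
      obtain rfl : n = n₀ + m * q := by omega
      have hc : ((NCPA A n₀).card : ℝ) * (NCPA A m).card ^ q ≤ (NCPA A (n₀ + m * q)).card := by
        exact_mod_cast pow_mul_card_NCPA_le A m n₀ q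
      calc ((NCPA A n₀).card : ℝ) * z ^ n₀
          ≤ (NCPA A n₀).card * z ^ n₀ * ((NCPA A m).card * z ^ m) ^ q :=
            le_mul_of_one_le_right (by positivity) (one_le_pow₀ h1)
        _ = (NCPA A n₀).card * (NCPA A m).card ^ q * z ^ (n₀ + m * q) := by ring
        _ ≤ _ := by gcongr
    · exact ⟨1, one_pos, fun n hn hne => absurd ⟨n, hn, hne⟩ hr⟩
  choose δ hδ hδle using hres
  have hne : (Finset.range m).Nonempty := Finset.nonempty_range_iff.2 hm.ne'
  refine ⟨(Finset.range m).inf' hne δ, (Finset.lt_inf'_iff hne).2 fun r _ => hδ r, fun n hn => ?_⟩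
  exact (Finset.inf'_le δ (Finset.mem_range.2 (Nat.mod_lt n hm))).trans (hδle _ n rfl hn)

theorem exists_lower_bound_of_lt {A : Set ℕ} (hApos : ∀ a ∈ A, 1 ≤ a) {ξ : ℝ} (hξ : 0 < ξ)
    (hξsum' : Summable fun i : A => ξ ^ (i : ℕ))
    (hξsum : Summable fun i : A => (i : ℝ) * ξ ^ (i : ℕ))
    (hξeq : 1 + ∑' i : A, ξ ^ (i : ℕ) = ∑' i : A, (i : ℝ) * ξ ^ (i : ℕ)) {z : ℝ}
    (hz : ξ / (1 + ∑' i : A, ξ ^ (i : ℕ)) < z) :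
    ∃ δ : ℝ, 0 < δ ∧ ∀ n, (NCPA A n).Nonempty → δ ≤ ((NCPA A n).card : ℝ) * z ^ n := by
  set φ := 1 + ∑' i : A, ξ ^ (i : ℕ) with hφ
  have hφpos : 0 < φ := by
    have : 0 ≤ ∑' i : A, ξ ^ (i : ℕ) := tsum_nonneg fun i => by positivity
    linarith
  have hρ : 0 < ξ / φ := div_pos hξ hφpos
  have hz0 : 0 < z := hρ.trans hz
  by_contra hcon
  have hlt : ∀ m, ((NCPA A m).card : ℝ) * z ^ m ≤ 1 := by
    intro m
    rcases Nat.eq_zero_or_pos m with rfl | hm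
    · simpa using card_NCPA_zero_le A
    · by_contra! h
      exact hcon (exists_lower_bound hz0 hm h.le)
  obtain ⟨y, hy1, hy2⟩ := exists_between hz
  have hy0 : 0 < y := hρ.trans hy1
  have hsum : Summable fun n => ((NCPA A n).card : ℝ) * y ^ n := by
    refine Summable.of_nonneg_of_le (fun n => by positivity) (fun n => ?_)
      (summable_geometric_of_lt_one (by positivity : 0 ≤ y / z) ((div_lt_one hz0).2 hy2))
    rw [div_pow, le_div_iff₀ (by positivity)]
    calc ((NCPA A n).card : ℝ) * y ^ n * z ^ n = (NCPA A n).card * z ^ n * y ^ n := by ring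
      _ ≤ 1 * y ^ n := by gcongr; exact hlt n
      _ = y ^ n := one_mul _
  obtain ⟨t, ht, htsum, hle⟩ := exists_supersolution hApos hy0 hsum
  have htan := one_add_tsum_tangent_le hξ ht hξsum' hξsum hξeq htsum
  rw [div_lt_iff₀ hφpos] at hy1
  have hS : 0 < 1 + ∑' i : A, t ^ (i : ℕ) := by
    have : 0 ≤ ∑' i : A, t ^ (i : ℕ) := tsum_nonneg fun i => by positivity
    linarith
  have h1 := mul_le_mul_of_nonneg_right hle hφpos.le
  have h2 := mul_lt_mul_of_pos_right hy1 hS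
  linarith [mul_right_comm y (1 + ∑' i : A, t ^ (i : ℕ)) φ]

theorem sum_pow_card_filter_mul_le {A : Set ℕ} (hApos : ∀ a ∈ A, 1 ≤ a) {ξ : ℝ} (hξ : 0 < ξ)
    (hξsum' : Summable fun i : A => ξ ^ (i : ℕ)) {k : ℕ} (hkA : k ∈ A) {u : ℝ} (hu : 0 < u)
    (n : ℕ) :
    (∑ P ∈ NCPA A n, u ^ (P.filter (·.card = k)).card) * ξ ^ n ≤
      (1 + ∑' i : A, ξ ^ (i : ℕ) + (u - 1) * ξ ^ k) ^ n := by
  have hk : k ≠ 0 := Nat.one_le_iff_ne_zero.1 (hApos k hkA)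
  set ω : ℕ → ℝ := fun j => (if j = k then u else 1) * ξ ^ j with hω
  have hω0 : ∀ j, 0 ≤ ω j := fun j => by
    simp only [hω]
    split_ifs <;> positivity
  have hω1 : ω 0 = 1 := by simp [hω, hk.symm]
  have hprod : ∀ P ∈ NCPA A n,
      ∏ B ∈ P, ω B.card = u ^ (P.filter (·.card = k)).card * ξ ^ n := by
    intro P hP
    simp only [hω]
    rw [Finset.prod_mul_distrib, Finset.prod_pow_eq_pow_sum, (mem_NCPA_iff.1 hP).1.sum_card,
      ← Finset.prod_filter, Finset.prod_const]
  have hωsum : HasSum (fun i : A => ω i) (∑' i : A, ξ ^ (i : ℕ) + (u - 1) * ξ ^ k) := by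
    refine (hξsum'.hasSum.add (hasSum_ite_eq (⟨k, hkA⟩ : A) ((u - 1) * ξ ^ k))).congr_fun ?_
    intro i
    simp only [hω, Subtype.ext_iff]
    split_ifs with h
    · rw [h]
      ring
    · ring
  rw [Finset.sum_mul, ← Finset.sum_congr rfl hprod]
  refine (sum_prod_card_le A n hω1 hω0).trans ?_
  refine pow_le_pow_left₀ (Finset.sum_nonneg fun j _ => hω0 j) ?_ n
  rw [Finset.sum_insert (by simp), hω1, add_assoc, ← Finset.sum_subtype_eq_sum_filter]
  gcongr
  exact sum_le_hasSum _ (fun i _ => hω0 i) hωsum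

theorem card_mul_exp_mean_le {ι : Type*} (s : Finset ι) (f : ι → ℝ) :
    (s.card : ℝ) * Real.exp ((∑ i ∈ s, f i) / s.card) ≤ ∑ i ∈ s, Real.exp (f i) := by
  rcases s.eq_empty_or_nonempty with rfl | hs
  · simp
  have hc : (0 : ℝ) < s.card := by exact_mod_cast hs.card_pos
  set a := (∑ i ∈ s, f i) / s.card with ha
  have hterm : ∀ i ∈ s, Real.exp a * (1 + (f i - a)) ≤ Real.exp (f i) := by
    intro i _
    have h := Real.add_one_le_exp (f i - a)
    calc Real.exp a * (1 + (f i - a)) ≤ Real.exp a * Real.exp (f i - a) := by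
          gcongr
          linarith
      _ = Real.exp (f i) := by rw [← Real.exp_add, add_sub_cancel]
  refine le_of_eq_of_le ?_ (Finset.sum_le_sum hterm)
  rw [← Finset.mul_sum, Finset.sum_add_distrib, Finset.sum_sub_distrib, Finset.sum_const,
    Finset.sum_const, nsmul_eq_mul, nsmul_eq_mul, ha, mul_div_cancel₀ _ hc.ne']
  ring

/-- The mean number of blocks of size `k` of a uniform element of `NCPA A n`. -/
noncomputable def meanBlocks (A : Set ℕ) (k n : ℕ) : ℝ :=
  (∑ P ∈ NCPA A n, ((P.filter (·.card = k)).card : ℝ)) / (NCPA A n).card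

theorem exists_mul_meanBlocks_sub_le {A : Set ℕ} (hApos : ∀ a ∈ A, 1 ≤ a) {ξ : ℝ} (hξ : 0 < ξ)
    (hξsum' : Summable fun i : A => ξ ^ (i : ℕ))
    (hξsum : Summable fun i : A => (i : ℝ) * ξ ^ (i : ℕ))
    (hξeq : 1 + ∑' i : A, ξ ^ (i : ℕ) = ∑' i : A, (i : ℝ) * ξ ^ (i : ℕ))
    {k : ℕ} (hkA : k ∈ A) {s : ℝ} (hs0 : s ≠ 0) (hs1 : |s| ≤ 1) :
    ∃ L : ℝ, ∀ n, 1 ≤ n → (NCPA A n).Nonempty →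
      s * (meanBlocks A k n / n - ξ ^ k / (1 + ∑' i : A, ξ ^ (i : ℕ))) ≤ 2 * s ^ 2 + L / n := by
  have hterm : ξ ^ k ≤ ∑' i : A, ξ ^ (i : ℕ) :=
    hξsum'.le_tsum (⟨k, hkA⟩ : A) fun i _ => by positivity
  have hξk : 0 < ξ ^ k := by positivity
  set φ := 1 + ∑' i : A, ξ ^ (i : ℕ) with hφ
  have hφ0 : 0 < φ := by linarith
  set p := ξ ^ k / φ with hp
  have hp0 : 0 ≤ p := by positivity
  have hp1 : p ≤ 1 := (div_le_one hφ0).2 (by linarith)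
  have hz : ξ / φ < ξ / φ * Real.exp (s ^ 2) :=
    lt_mul_of_one_lt_right (by positivity) (Real.one_lt_exp_iff.2 (by positivity))
  obtain ⟨δ, hδ, hδle⟩ := exists_lower_bound_of_lt hApos hξ hξsum' hξsum hξeq hz
  refine ⟨-Real.log δ, fun n hn hne => ?_⟩
  have hn0 : (0 : ℝ) < n := by exact_mod_cast hn
  have hc0 : (0 : ℝ) < (NCPA A n).card := by exact_mod_cast hne.card_pos
  have hlow := hδle n hne
  have hup := sum_pow_card_filter_mul_le hApos hξ hξsum' hkA (Real.exp_pos s) n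
  have hjensen := card_mul_exp_mean_le (NCPA A n) fun P => s * (P.filter (·.card = k)).card
  rw [← Finset.mul_sum, mul_div_assoc, ← meanBlocks] at hjensen
  simp_rw [mul_comm s ((_ : ℕ) : ℝ), Real.exp_nat_mul] at hjensen
  have hbase : 0 ≤ φ + (Real.exp s - 1) * ξ ^ k := by
    have := mul_pos (Real.exp_pos s) hξk
    linarith
  have hexp : φ + (Real.exp s - 1) * ξ ^ k ≤ φ * Real.exp (p * s + s ^ 2) := by
    have h1 : Real.exp s - 1 ≤ s + s ^ 2 := by
      have := (abs_le.1 (Real.abs_exp_sub_one_sub_id_le hs1)).2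
      linarith
    have h2 := Real.add_one_le_exp (p * s + s ^ 2)
    have h3 : φ + (Real.exp s - 1) * ξ ^ k = φ * (1 + (Real.exp s - 1) * p) := by
      rw [hp]
      field_simp
    rw [h3]
    gcongr
    nlinarith [mul_le_mul_of_nonneg_right h1 hp0, mul_nonneg (sq_nonneg s) (sub_nonneg.2 hp1)]
  have hmain : δ * Real.exp (s * meanBlocks A k n) ≤ Real.exp (n * (p * s + 2 * s ^ 2)) := by
    have h1 : (NCPA A n).card * Real.exp (s * meanBlocks A k n) * ξ ^ n ≤
        φ ^ n * Real.exp (n * (p * s + s ^ 2)) := by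
      rw [Real.exp_nat_mul, ← mul_pow]
      refine (mul_le_mul_of_nonneg_right hjensen (by positivity)).trans (hup.trans ?_)
      exact pow_le_pow_left₀ hbase hexp n
    calc δ * Real.exp (s * meanBlocks A k n)
        ≤ (NCPA A n).card * (ξ / φ * Real.exp (s ^ 2)) ^ n *
            Real.exp (s * meanBlocks A k n) := by gcongr
      _ = (NCPA A n).card * Real.exp (s * meanBlocks A k n) * ξ ^ n *
            (Real.exp (n * s ^ 2) / φ ^ n) := by
          rw [mul_pow, div_pow, Real.exp_nat_mul]
          ring
      _ ≤ φ ^ n * Real.exp (n * (p * s + s ^ 2)) * (Real.exp (n * s ^ 2) / φ ^ n) := by gcongr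
      _ = Real.exp (n * (p * s + s ^ 2)) * Real.exp (n * s ^ 2) := by field_simp
      _ = Real.exp (n * (p * s + 2 * s ^ 2)) := by
          rw [← Real.exp_add]
          congr 1
          ring
  have hlog := Real.log_le_log (by positivity) hmain
  rw [Real.log_mul hδ.ne' (Real.exp_pos _).ne', Real.log_exp, Real.log_exp] at hlog
  have hdiv : s * (meanBlocks A k n / n - p) * n ≤ (2 * s ^ 2 + -Real.log δ / n) * n := by
    have h1 : s * (meanBlocks A k n / n - p) * n = s * meanBlocks A k n - n * (p * s) := by
      field_simp
    have h2 : (2 * s ^ 2 + -Real.log δ / n) * n = n * (2 * s ^ 2) - Real.log δ := by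
      field_simp
      ring
    rw [h1, h2]
    linarith
  exact le_of_mul_le_mul_right hdiv hn0

theorem tendsto_meanBlocks {A : Set ℕ} (hApos : ∀ a ∈ A, 1 ≤ a) {ξ : ℝ} (hξ : 0 < ξ)
    (hξsum' : Summable fun i : A => ξ ^ (i : ℕ))
    (hξsum : Summable fun i : A => (i : ℝ) * ξ ^ (i : ℕ))
    (hξeq : 1 + ∑' i : A, ξ ^ (i : ℕ) = ∑' i : A, (i : ℝ) * ξ ^ (i : ℕ))
    {k : ℕ} (hkA : k ∈ A) :
    Filter.Tendsto (fun n : ℕ => meanBlocks A k n / n)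
      (Filter.atTop ⊓ Filter.principal {n : ℕ | (NCPA A n).Nonempty})
      (nhds (ξ ^ k / (1 + ∑' i : A, ξ ^ (i : ℕ)))) := by
  rw [Metric.tendsto_nhds]
  intro ε hε
  set s := min 1 (ε / 4) with hs
  have hs0 : 0 < s := lt_min one_pos (by positivity)
  have hs1 : s ≤ 1 := min_le_left _ _
  have hsε : 4 * s ≤ ε := by linarith [min_le_right 1 (ε / 4)]
  obtain ⟨L, hL⟩ := exists_mul_meanBlocks_sub_le hApos hξ hξsum' hξsum hξeq hkA hs0.ne'
    (by rwa [abs_of_pos hs0])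
  obtain ⟨L', hL'⟩ := exists_mul_meanBlocks_sub_le hApos hξ hξsum' hξsum hξeq hkA
    (neg_ne_zero.2 hs0.ne') (by rwa [abs_neg, abs_of_pos hs0])
  have hsmall : ∀ M : ℝ, ∀ᶠ n : ℕ in Filter.atTop, M / n < s ^ 2 := fun M =>
    (tendsto_const_div_atTop_nhds_zero_nat M).eventually_lt_const (by positivity)
  rw [Filter.eventually_inf_principal]
  filter_upwards [hsmall L, hsmall L', Filter.eventually_ge_atTop 1] with n h1 h2 hn hne
  have h3 := hL n hn hne
  have h4 := hL' n hn hne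
  rw [Real.dist_eq, abs_lt]
  constructor <;> nlinarith

theorem ratio_eq_mul_meanBlocks (A : Set ℕ) (k : ℕ) {n : ℕ} (hn : 1 ≤ n) :
    ((blockSizeNCP A k n 1).card : ℝ) / (NCPA A n).card = k * (meanBlocks A k n / n) := by
  have hn0 : (n : ℝ) ≠ 0 := by exact_mod_cast (by omega : n ≠ 0)
  have h : (n : ℝ) * (blockSizeNCP A k n 1).card =
      k * ∑ P ∈ NCPA A n, ((P.filter (·.card = k)).card : ℝ) := by
    exact_mod_cast mul_card_blockSizeNCP_one A k n
  rw [meanBlocks, div_div, mul_comm ((NCPA A n).card : ℝ), ← mul_div_assoc, ← h,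
    mul_div_mul_left _ _ hn0]

/-- in a uniform non-crossing partition of `[n]` with block sizes in `A`,
the probability that the block containing `1` has size `k` tends to `k·π_A(k)`. -/
theorem stmt0 (A : Set ℕ) (hA : A.Nonempty) (hApos : ∀ a ∈ A, 1 ≤ a) (hA1 : A ≠ {1})
    (ξ : ℝ) (hξpos : 0 < ξ)
    (hξsum : Summable fun i : A => (i : ℝ) * ξ ^ (i : ℕ))
    (hξeq : 1 + ∑' i : A, ξ ^ (i : ℕ) = ∑' i : A, (i : ℝ) * ξ ^ (i : ℕ))
    (k : ℕ) (hk : 1 ≤ k) :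
    Filter.Tendsto
      (fun n : ℕ =>
        (((NCPA A n).filter fun P => ∃ B ∈ P, 1 ∈ B ∧ B.card = k).card : ℝ) /
          ((NCPA A n).card : ℝ))
      (Filter.atTop ⊓ Filter.principal {n : ℕ | (NCPA A n).Nonempty})
      (nhds ((k : ℝ) * piA A ξ k)) := by
  have hξsum' : Summable fun i : A => ξ ^ (i : ℕ) := by
    refine Summable.of_nonneg_of_le (fun i => by positivity) (fun i => ?_) hξsum
    have : (1 : ℝ) ≤ (i : ℕ) := by exact_mod_cast hApos i i.2
    exact le_mul_of_one_le_left (by positivity) this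
  by_cases hkA : k ∈ A
  · rw [piA, if_pos (Or.inr hkA)]
    refine ((tendsto_meanBlocks hApos hξpos hξsum' hξsum hξeq hkA).const_mul (k : ℝ)).congr' ?_
    filter_upwards [Filter.mem_inf_of_left (Filter.eventually_ge_atTop 1)] with n hn
    exact (ratio_eq_mul_meanBlocks A k hn).symm
  · rw [piA, if_neg (by rintro (rfl | h) <;> simp_all), mul_zero]
    refine tendsto_const_nhds.congr fun n => ?_
    rw [Finset.filter_false_of_mem, Finset.card_empty, Nat.cast_zero, zero_div]
    rintro P hP ⟨B, hB, -, rfl⟩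
    exact hkA ((mem_NCPA_iff.1 hP).2.2 B hB)
end

section
/- Let A ⊆ ℕ be a nonempty set with A ≠ {1}. For every integer k ≥ 1, the average (1/#ℕℂ^A_n)·Σ_{P ∈ ℕℂ^A_n} N_k(P)/ζ(P), where N_k(P) is the number of blocks of P of size k and ζ(P) is the total number of blocks of P (this average is the probability that a block chosen uniformly at random in a uniformly random element of ℕℂ^A_n has size k), converges to π_A(k)/(1 − π_A(0)) as n → ∞ along the set of integers n for which ℕℂ^A_n is nonempty. -/
open scoped Classical

open scoped ENNReal

/-- `lukCount w n h` is the total weight of the words with `n` letters in `ℕ` that lead a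
Łukasiewicz path from height `h` to height `0`, where the letter `i` has weight `w i` and changes
the height by `i - 1`. -/
noncomputable def lukCount (w : ℕ → ℝ≥0∞) : ℕ → ℕ → ℝ≥0∞
  | 0, 0 => 1
  | 0, _ + 1 => 0
  | n + 1, 0 => ∑' i, w (i + 1) * lukCount w n i
  | n + 1, h + 1 => ∑' i, w i * lukCount w n (h + i)

theorem lukCount_mul_pow_le (w : ℕ → ℝ≥0∞) (u : ℝ≥0∞) (n h : ℕ) :
    lukCount w n h * u ^ n ≤ (∑' i, w i * u ^ i) ^ n * u ^ h := by
  induction n generalizing h with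
  | zero => cases h <;> simp [lukCount]
  | succ n ih =>
    have step : ∀ (v : ℕ → ℝ≥0∞) (e : ℕ → ℕ), (∑' i, v i * lukCount w n (e i)) * u ^ (n + 1) ≤
        (∑' i, w i * u ^ i) ^ n * ∑' i, v i * u ^ (e i + 1) := by
      intro v e
      rw [← ENNReal.tsum_mul_right, ← ENNReal.tsum_mul_left]
      refine ENNReal.tsum_le_tsum fun i => ?_
      calc v i * lukCount w n (e i) * u ^ (n + 1)
          = v i * u * (lukCount w n (e i) * u ^ n) := by ring
        _ ≤ v i * u * ((∑' i, w i * u ^ i) ^ n * u ^ e i) := mul_le_mul_right (ih _) _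
        _ = _ := by ring
    cases h with
    | zero =>
      refine (step (fun i => w (i + 1)) fun i => i).trans ?_
      rw [pow_zero, mul_one, pow_succ]
      refine mul_le_mul_right ?_ _
      exact ENNReal.tsum_comp_le_tsum_of_injective (add_left_injective 1) (fun i => w i * u ^ i)
    | succ h =>
      refine (step w fun i => h + i).trans ?_
      rw [pow_succ _ n, mul_assoc, ← ENNReal.tsum_mul_right]
      refine mul_le_mul_right (ENNReal.tsum_le_tsum fun i => ?_) _
      exact le_of_eq (by ring)

theorem lukCount_mul_le (w : ℕ → ℝ≥0∞) (m n a b : ℕ) :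
    lukCount w m a * lukCount w n b ≤ lukCount w (m + n) (a + b) := by
  induction m generalizing a with
  | zero => cases a <;> simp [lukCount]
  | succ m ih =>
    have step : ∀ i j k, i + b = j → w k * lukCount w m i * lukCount w n b ≤
        w k * lukCount w (m + n) j := by
      rintro i _ k rfl
      rw [mul_assoc]
      gcongr
      exact ih i
    rw [show m + 1 + n = m + n + 1 by ring]
    cases a with
    | zero =>
      cases b with
      | zero =>
        rw [lukCount, lukCount, ← ENNReal.tsum_mul_right]
        exact ENNReal.tsum_le_tsum fun i => step _ _ _ (by ring)
      | succ b =>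
        rw [lukCount, show 0 + (b + 1) = b + 1 by ring, lukCount.eq_4, ← ENNReal.tsum_mul_right]
        refine (ENNReal.tsum_le_tsum fun i => step i (b + (i + 1)) _ (by ring)).trans ?_
        exact ENNReal.tsum_comp_le_tsum_of_injective (add_left_injective 1)
          (fun i => w i * lukCount w (m + n) (b + i))
    | succ a =>
      rw [lukCount, show a + 1 + b = a + b + 1 by ring, lukCount.eq_4, ← ENNReal.tsum_mul_right]
      exact ENNReal.tsum_le_tsum fun i => step _ _ _ (by ring)

/-- First-passage decomposition of Łukasiewicz paths. -/
theorem sum_antidiagonal_lukCount (w : ℕ → ℝ≥0∞) (hw : w 0 = 1) (n a b : ℕ) :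
    ∑ p ∈ Finset.HasAntidiagonal.antidiagonal n, lukCount w p.1 a * lukCount w p.2 b =
      lukCount w (n + 1) (a + b + 1) := by
  induction n generalizing a with
  | zero =>
    rw [lukCount.eq_4, tsum_eq_single 0]
    · cases a <;> cases b <;> simp [lukCount, hw]
    · intro i hi
      obtain ⟨i, rfl⟩ := Nat.exists_eq_succ_of_ne_zero hi
      simp [lukCount]
  | succ n ih =>
    rw [Finset.Nat.sum_antidiagonal_succ, lukCount.eq_4]
    cases a with
    | zero =>
      rw [tsum_eq_zero_add' ENNReal.summable]
      simp only [lukCount.eq_1, lukCount.eq_3, hw, ← ENNReal.tsum_mul_right]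
      rw [← Summable.tsum_finsetSum fun _ _ => ENNReal.summable]
      congr 1
      · simp
      · refine tsum_congr fun i => ?_
        rw [show 0 + b + (i + 1) = i + b + 1 by ring, ← ih i, Finset.mul_sum]
        exact Finset.sum_congr rfl fun _ _ => by ring
    | succ a =>
      simp only [lukCount, ← ENNReal.tsum_mul_right]
      rw [← Summable.tsum_finsetSum fun _ _ => ENNReal.summable, zero_mul, zero_add]
      refine tsum_congr fun i => ?_
      rw [show a + 1 + b + i = a + i + b + 1 by ring, ← ih (a + i), Finset.mul_sum]
      exact Finset.sum_congr rfl fun _ _ => by ring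

/-- The generating function of `lukCount w · h`. -/
noncomputable def lukSeries (w : ℕ → ℝ≥0∞) (z : ℝ≥0∞) (h : ℕ) : ℝ≥0∞ :=
  ∑' n, lukCount w n h * z ^ n

theorem lukSeries_add_add_one (w : ℕ → ℝ≥0∞) (hw : w 0 = 1) (z : ℝ≥0∞) (a b : ℕ) :
    lukSeries w z (a + b + 1) = z * (lukSeries w z a * lukSeries w z b) := by
  unfold lukSeries
  rw [tsum_eq_zero_add' ENNReal.summable, lukCount, zero_mul, zero_add, ← ENNReal.tsum_mul_right,
    ← ENNReal.tsum_mul_left]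
  simp_rw [← ENNReal.tsum_mul_left]
  rw [← ENNReal.tsum_prod (f := fun i j => z * (lukCount w i a * z ^ i * (lukCount w j b * z ^ j))),
    ← Finset.HasAntidiagonal.sigmaAntidiagonalEquivProd.tsum_eq, ENNReal.tsum_sigma']
  refine tsum_congr fun n => ?_
  rw [← sum_antidiagonal_lukCount w hw, Finset.sum_mul, ← Finset.tsum_subtype]
  refine tsum_congr fun p => ?_
  obtain ⟨p, hp⟩ := p
  rw [Finset.HasAntidiagonal.mem_antidiagonal] at hp
  simp only [Finset.HasAntidiagonal.sigmaAntidiagonalEquivProd_apply, ← hp]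
  ring

theorem lukSeries_eq_pow (w : ℕ → ℝ≥0∞) (hw : w 0 = 1) (z : ℝ≥0∞) (h : ℕ) :
    lukSeries w z h = lukSeries w z 0 * (z * lukSeries w z 0) ^ h := by
  induction h with
  | zero => simp
  | succ h ih =>
    rw [show h + 1 = h + 0 + 1 by ring, lukSeries_add_add_one w hw z h 0, ih]
    ring

theorem lukSeries_zero_eq (w : ℕ → ℝ≥0∞) (hw : w 0 = 1) (z : ℝ≥0∞) :
    lukSeries w z 0 = ∑' i, w i * (z * lukSeries w z 0) ^ i := by
  have h : lukSeries w z 0 = 1 + ∑' i, w (i + 1) * (z * lukSeries w z i) := by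
    conv_lhs => unfold lukSeries
    rw [tsum_eq_zero_add' ENNReal.summable]
    congr 1
    · simp [lukCount]
    · simp only [lukCount, lukSeries, ← ENNReal.tsum_mul_right, ← ENNReal.tsum_mul_left]
      rw [ENNReal.tsum_comm]
      refine tsum_congr fun i => tsum_congr fun n => ?_
      ring
  rw [tsum_eq_zero_add' ENNReal.summable, hw, pow_zero, mul_one]
  conv_lhs => rw [h]
  congr 1
  refine tsum_congr fun i => ?_
  rw [lukSeries_eq_pow w hw z i]
  ring

theorem lukCount_mul_pow_le_add_mul (w : ℕ → ℝ≥0∞) (r p q : ℕ) :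
    lukCount w r 0 * lukCount w p 0 ^ q ≤ lukCount w (r + p * q) 0 := by
  induction q with
  | zero => simp
  | succ q ih =>
    calc lukCount w r 0 * lukCount w p 0 ^ (q + 1)
        = lukCount w r 0 * lukCount w p 0 ^ q * lukCount w p 0 := by ring
      _ ≤ lukCount w (r + p * q) 0 * lukCount w p 0 := mul_le_mul_left ih _
      _ ≤ lukCount w (r + p * q + p) (0 + 0) := lukCount_mul_le ..
      _ = _ := by ring_nf

theorem ENNReal.one_add_natCast_mul_le_pow_add (t : ℝ≥0∞) (i : ℕ) : 1 + i * t ≤ t ^ i + i := by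
  induction t with
  | top => cases i <;> simp
  | coe t =>
    norm_cast
    rw [← NNReal.coe_le_coe]
    push_cast
    have := one_add_mul_le_pow (a := (t : ℝ) - 1) (by linarith [t.coe_nonneg]) i
    rw [add_sub_cancel] at this
    linarith

/-- The tangent line at a critical point `u` of the power series `∑ w i * v ^ i` passes through the
origin and lies below the graph. -/
theorem tsum_mul_le_of_critical {w : ℕ → ℝ≥0∞} {u : ℝ≥0∞} (hu0 : u ≠ 0) (hu : u ≠ ∞)
    (hcrit : ∑' i, w i * u ^ i = ∑' i, w i * (i * u ^ i)) (hfin : ∑' i, w i * u ^ i ≠ ∞)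
    (v : ℝ≥0∞) : (∑' i, w i * u ^ i) * v ≤ u * ∑' i, w i * v ^ i := by
  obtain ⟨t, rfl⟩ : ∃ t, v = u * t := ⟨v / u, (ENNReal.mul_div_cancel hu0 hu).symm⟩
  have key : ∑' i, w i * u ^ i + (∑' i, w i * u ^ i) * t ≤
      ∑' i, w i * (u * t) ^ i + ∑' i, w i * u ^ i := by
    nth_rw 2 [hcrit]
    nth_rw 2 [hcrit]
    rw [← ENNReal.tsum_mul_right, ← ENNReal.tsum_add, ← ENNReal.tsum_add]
    refine ENNReal.tsum_le_tsum fun i => ?_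
    calc w i * u ^ i + w i * (i * u ^ i) * t = w i * u ^ i * (1 + i * t) := by ring
      _ ≤ w i * u ^ i * (t ^ i + i) :=
        mul_le_mul_right (ENNReal.one_add_natCast_mul_le_pow_add t i) _
      _ = _ := by ring
  rw [add_comm, ENNReal.add_le_add_iff_right hfin] at key
  calc (∑' i, w i * u ^ i) * (u * t) = u * ((∑' i, w i * u ^ i) * t) := by ring
    _ ≤ _ := mul_le_mul_right key u

theorem exists_pow_le_lukCount {w : ℕ → ℝ≥0∞} (hw : w 0 = 1) {u ρ : ℝ≥0∞} (hu0 : u ≠ 0)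
    (hu : u ≠ ∞) (hcrit : ∑' i, w i * u ^ i = ∑' i, w i * (i * u ^ i))
    (hfin : ∑' i, w i * u ^ i ≠ ∞) (hρ : ρ < (∑' i, w i * u ^ i) / u) :
    ∃ p, 1 ≤ p ∧ ρ ^ p ≤ lukCount w p 0 := by
  by_contra! hlt
  have hle : ∀ p, lukCount w p 0 ≤ ρ ^ p := fun p => by
    rcases Nat.eq_zero_or_pos p with rfl | hp
    · simp [lukCount]
    · exact (hlt p hp).le
  obtain ⟨σ, hρσ, hσ⟩ := exists_between hρ
  have hσ0 : σ ≠ 0 := (zero_le.trans_lt hρσ).ne'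
  have hσt : σ ≠ ∞ := hσ.ne_top
  set C := lukSeries w σ⁻¹ 0 with hC
  have hCt : C ≠ ∞ := by
    have : C ≤ ∑' n, (ρ / σ) ^ n := by
      refine ENNReal.tsum_le_tsum fun n => ?_
      rw [div_eq_mul_inv, mul_pow]
      exact mul_le_mul_left (hle n) _
    refine ne_top_of_le_ne_top ?_ this
    rw [ENNReal.tsum_geometric]
    simp only [ne_eq, ENNReal.inv_eq_top, tsub_eq_zero_iff_le, not_le]
    exact ENNReal.div_lt_of_lt_mul (by simpa using hρσ)
  have hC0 : C ≠ 0 := by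
    have : lukCount w 0 0 * σ⁻¹ ^ 0 ≤ C := ENNReal.le_tsum (f := fun n => lukCount w n 0 * σ⁻¹ ^ n) 0
    rintro h
    simp [h, lukCount] at this
  have h := tsum_mul_le_of_critical hu0 hu hcrit hfin (σ⁻¹ * C)
  rw [hC, ← lukSeries_zero_eq w hw, ← hC, ← mul_assoc, ENNReal.mul_le_mul_iff_left hC0 hCt,
    ← div_eq_mul_inv, ENNReal.div_le_iff hσ0 hσt, mul_comm] at h
  exact absurd hσ (not_lt.2 (ENNReal.div_le_of_le_mul h))

/-- Lower bound for the exponential growth of the number of Łukasiewicz words. -/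
theorem exists_mul_pow_le_lukCount {w : ℕ → ℝ≥0∞} (hw : w 0 = 1) {u ρ : ℝ≥0∞} (hu0 : u ≠ 0)
    (hu : u ≠ ∞) (hcrit : ∑' i, w i * u ^ i = ∑' i, w i * (i * u ^ i))
    (hfin : ∑' i, w i * u ^ i ≠ ∞) (hρ0 : ρ ≠ 0) (hρ : ρ < (∑' i, w i * u ^ i) / u) :
    ∃ K : ℝ≥0∞, 0 < K ∧ ∀ n, lukCount w n 0 ≠ 0 → K * ρ ^ n ≤ lukCount w n 0 := by
  obtain ⟨p, hp, hle⟩ := exists_pow_le_lukCount hw hu0 hu hcrit hfin hρ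
  have hρt : ρ ≠ ∞ := hρ.ne_top
  have hres : ∀ j, ∃ K : ℝ≥0∞, 0 < K ∧
      ∀ n, n % p = j → lukCount w n 0 ≠ 0 → K * ρ ^ n ≤ lukCount w n 0 := by
    intro j
    by_cases hj : ∃ n, n % p = j ∧ lukCount w n 0 ≠ 0
    · obtain ⟨hrj, hr0⟩ := Nat.find_spec hj
      set r := Nat.find hj
      refine ⟨lukCount w r 0 / ρ ^ r, ENNReal.div_pos hr0 (ENNReal.pow_ne_top hρt), ?_⟩
      intro n hnj hn0
      have hrn : r ≤ n := Nat.find_min' hj ⟨hnj, hn0⟩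
      obtain ⟨q, hq⟩ := (Nat.modEq_iff_dvd' hrn).1 (hrj.trans hnj.symm)
      obtain rfl : n = r + p * q := by omega
      calc lukCount w r 0 / ρ ^ r * ρ ^ (r + p * q)
          = lukCount w r 0 / ρ ^ r * ρ ^ r * (ρ ^ p) ^ q := by ring
        _ = lukCount w r 0 * (ρ ^ p) ^ q := by
          rw [ENNReal.div_mul_cancel (pow_ne_zero _ hρ0) (ENNReal.pow_ne_top hρt)]
        _ ≤ lukCount w r 0 * lukCount w p 0 ^ q := by gcongr
        _ ≤ _ := lukCount_mul_pow_le_add_mul w r p q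
    · exact ⟨1, one_pos, fun n hn h => (hj ⟨n, hn, h⟩).elim⟩
  choose K hK0 hK using hres
  refine ⟨(Finset.range p).inf K, ?_, fun n hn => ?_⟩
  · rw [Finset.lt_inf_iff ENNReal.zero_lt_top]
    exact fun j _ => hK0 j
  · have : (Finset.range p).inf K ≤ K (n % p) :=
      Finset.inf_le (Finset.mem_range.2 (Nat.mod_lt _ hp))
    exact (mul_le_mul_left this _).trans (hK _ n rfl hn)

/-- The set of the `h` largest elements of `C`. -/
noncomputable def topElems (h : ℕ) (C : Finset ℕ) : Finset ℕ :=
  C.filter fun x => (C.filter fun y => x < y).card < h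

theorem card_topElems (h : ℕ) (C : Finset ℕ) : (topElems h C).card = min h C.card := by
  induction C using Finset.induction_on_min with
  | empty => simp [topElems]
  | insert m C hm ih =>
    have hmC : m ∉ C := fun h => (hm m h).false
    have h1 : ∀ x ∈ C, (insert m C).filter (fun y => x < y) = C.filter fun y => x < y := by
      intro x hx
      rw [Finset.filter_insert, if_neg (hm x hx).not_gt]
    have h2 : (insert m C).filter (fun y => m < y) = C := by
      rw [Finset.filter_insert, if_neg (lt_irrefl m), Finset.filter_true_of_mem hm]
    have h3 : topElems h (insert m C) =
        if C.card < h then insert m (topElems h C) else topElems h C := by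
      unfold topElems
      rw [Finset.filter_insert, h2]
      have : C.filter (fun x => ((insert m C).filter fun y => x < y).card < h) =
          C.filter fun x => (C.filter fun y => x < y).card < h :=
        Finset.filter_congr fun x hx => by rw [h1 x hx]
      rw [this]
    have hmT : m ∉ topElems h C := fun h => hmC (Finset.mem_filter.1 h).1
    rw [h3, Finset.card_insert_of_notMem hmC]
    split_ifs with hc
    · rw [Finset.card_insert_of_notMem hmT, ih]; omega
    · rw [ih]; omega

theorem topElems_subset (h : ℕ) (C : Finset ℕ) : topElems h C ⊆ C := Finset.filter_subset _ _

theorem mem_topElems_of_lt {h : ℕ} {C : Finset ℕ} {x y : ℕ} (hx : x ∈ topElems h C) (hy : y ∈ C)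
    (hxy : x < y) : y ∈ topElems h C := by
  rw [topElems, Finset.mem_filter] at hx ⊢
  refine ⟨hy, lt_of_le_of_lt (Finset.card_le_card fun z hz => ?_) hx.2⟩
  rw [Finset.mem_filter] at hz ⊢
  exact ⟨hz.1, hxy.trans hz.2⟩

theorem topElems_union_eq {U D : Finset ℕ} (h : ∀ x ∈ D, ∀ y ∈ U, x < y) :
    topElems U.card (U ∪ D) = U := by
  symm
  apply Finset.eq_of_subset_of_card_le
  · intro x hx
    rw [topElems, Finset.mem_filter]
    refine ⟨Finset.mem_union_left _ hx, Finset.card_lt_card ?_⟩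
    refine Finset.ssubset_iff_of_subset ?_ |>.2 ⟨x, hx, by simp⟩
    intro y hy
    simp only [Finset.mem_filter, Finset.mem_union] at hy
    rcases hy with ⟨hy | hy, hxy⟩
    · exact hy
    · exact absurd (h y hy x hx) hxy.not_gt
  · rw [card_topElems]
    exact min_le_left _ _

/-- `(B, Q)` consists of the block `B` of `a` and the set `Q` of the other blocks of a non-crossing
partition of `{a, …, n}`. -/
structure IsPointedNC (a n : ℕ) (B : Finset ℕ) (Q : Finset (Finset ℕ)) : Prop where
  mem : a ∈ B
  block_subset : ∀ x ∈ B, a ≤ x ∧ x ≤ n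
  subset : ∀ C ∈ Q, ∀ x ∈ C, a ≤ x ∧ x ≤ n
  nonempty : ∀ C ∈ Q, C.Nonempty
  notMem_block : ∀ C ∈ Q, ∀ x ∈ C, x ∉ B
  eq_of_mem : ∀ C ∈ Q, ∀ D ∈ Q, ∀ x, x ∈ C → x ∈ D → C = D
  cover : ∀ x, a ≤ x → x ≤ n → x ∈ B ∨ ∃ C ∈ Q, x ∈ C
  nonCrossing : IsNonCrossing (insert B Q)

/-- Merge the block of `a`, with `a` removed, with the block of `a + 1`. -/
noncomputable def mergeFirst (a : ℕ) (p : Finset ℕ × Finset (Finset ℕ)) :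
    Finset ℕ × Finset (Finset ℕ) :=
  (p.1.erase a ∪ (p.2.filter fun C => a + 1 ∈ C).biUnion id, p.2.filter fun C => a + 1 ∉ C)

/-- Split off the `h` largest elements of the first block and add `a` to them. -/
noncomputable def splitFirst (a h : ℕ) (p : Finset ℕ × Finset (Finset ℕ)) :
    Finset ℕ × Finset (Finset ℕ) :=
  (insert a (topElems h p.1), if p.1.card = h then p.2 else insert (p.1 \ topElems h p.1) p.2)

namespace IsPointedNC

variable {a n : ℕ} {B : Finset ℕ} {Q : Finset (Finset ℕ)}

theorem lt_of_mem_of_mem (hp : IsPointedNC a n B Q) {D : Finset ℕ} (hD : D ∈ Q) (haD : a + 1 ∈ D)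
    {x y : ℕ} (hx : x ∈ D) (hy : y ∈ B.erase a) : x < y := by
  obtain ⟨hya, hyB⟩ := Finset.mem_erase.1 hy
  have h1 := hp.notMem_block D hD
  have h2 := hp.subset D hD x hx
  have h3 := hp.block_subset y hyB
  by_contra! hxy
  have hne : B ≠ D := by
    rintro rfl
    exact h1 y hyB hyB
  have h4 : y ≠ x := by rintro rfl; exact h1 y hx hyB
  have h5 : a + 1 ≠ y := by rintro rfl; exact h1 _ haD hyB
  exact hp.nonCrossing B (Finset.mem_insert_self _ _) D (Finset.mem_insert_of_mem hD) hne
    a (a + 1) y x (by omega) (by omega) (by omega) hp.mem hyB haD hx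

/-- In the presence of a separate block `D` of `a + 1`, `mergeFirst` has a simple form. -/
theorem mergeFirst_eq_of_mem (hp : IsPointedNC a n B Q) {D : Finset ℕ} (hD : D ∈ Q)
    (haD : a + 1 ∈ D) : mergeFirst a (B, Q) = (B.erase a ∪ D, Q.erase D) := by
  have h : Q.filter (fun C => a + 1 ∈ C) = {D} := by
    ext C
    simp only [Finset.mem_filter, Finset.mem_singleton]
    exact ⟨fun h => hp.eq_of_mem C h.1 D hD _ h.2 haD, by rintro rfl; exact ⟨hD, haD⟩⟩
  have h' : Q.filter (fun C => a + 1 ∉ C) = Q.erase D := by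
    ext C
    simp only [Finset.mem_filter, Finset.mem_erase]
    refine ⟨fun h => ⟨fun hCD => h.2 (hCD ▸ haD), h.1⟩, fun h => ⟨h.2, fun hC => h.1 ?_⟩⟩
    exact hp.eq_of_mem C h.2 D hD _ hC haD
  simp [mergeFirst, h, h']

theorem mergeFirst_eq_of_mem_block (hp : IsPointedNC a n B Q) (haB : a + 1 ∈ B) :
    mergeFirst a (B, Q) = (B.erase a, Q) := by
  have h : ∀ C ∈ Q, a + 1 ∉ C := fun C hC haC => hp.notMem_block C hC _ haC haB
  have h1 : Q.filter (fun C => a + 1 ∈ C) = ∅ := Finset.filter_false_of_mem h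
  have h2 : Q.filter (fun C => a + 1 ∉ C) = Q := Finset.filter_true_of_mem h
  simp [mergeFirst, h1, h2]

theorem ne_block (hp : IsPointedNC a n B Q) {C : Finset ℕ} (hC : C ∈ Q) : B ≠ C := by
  rintro rfl
  obtain ⟨x, hx⟩ := hp.nonempty B hC
  exact hp.notMem_block B hC x hx hx

theorem block_notMem (hp : IsPointedNC a n B Q) : B ∉ Q := fun h => hp.ne_block h rfl

theorem not_crossing_block (hp : IsPointedNC a n B Q) {C : Finset ℕ} (hC : C ∈ Q) {x y z t : ℕ}
    (hxy : x < y) (hyz : y < z) (hzt : z < t) (hx : x ∈ B) (hy : y ∈ C) (hz : z ∈ B) : t ∉ C :=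
  fun ht => hp.nonCrossing B (Finset.mem_insert_self _ _) C (Finset.mem_insert_of_mem hC)
    (hp.ne_block hC) x y z t hxy hyz hzt hx hz hy ht

theorem not_crossing_block' (hp : IsPointedNC a n B Q) {C : Finset ℕ} (hC : C ∈ Q) {x y z t : ℕ}
    (hxy : x < y) (hyz : y < z) (hzt : z < t) (hx : x ∈ C) (hy : y ∈ B) (hz : z ∈ C) : t ∉ B :=
  fun ht => hp.nonCrossing C (Finset.mem_insert_of_mem hC) B (Finset.mem_insert_self _ _)
    (hp.ne_block hC).symm x y z t hxy hyz hzt hx hz hy ht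

theorem not_crossing (hp : IsPointedNC a n B Q) {C D : Finset ℕ} (hC : C ∈ Q) (hD : D ∈ Q)
    (hCD : C ≠ D) {x y z t : ℕ}
    (hxy : x < y) (hyz : y < z) (hzt : z < t) (hx : x ∈ C) (hy : y ∈ D) (hz : z ∈ C) : t ∉ D :=
  fun ht => hp.nonCrossing C (Finset.mem_insert_of_mem hC) D (Finset.mem_insert_of_mem hD)
    hCD x y z t hxy hyz hzt hx hz hy ht

theorem isNonCrossing_insert
    (h1 : ∀ C ∈ Q, ∀ x y z t, x < y → y < z → z < t → x ∈ B → y ∈ C → z ∈ B → t ∉ C)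
    (h2 : ∀ C ∈ Q, ∀ x y z t, x < y → y < z → z < t → x ∈ C → y ∈ B → z ∈ C → t ∉ B)
    (h3 : IsNonCrossing Q) : IsNonCrossing (insert B Q) := by
  intro C hC D hD hCD x y z t hxy hyz hzt hx hz hy ht
  rw [Finset.mem_insert] at hC hD
  rcases hC with rfl | hC <;> rcases hD with rfl | hD
  · exact hCD rfl
  · exact h1 D hD x y z t hxy hyz hzt hx hy hz ht
  · exact h2 C hC x y z t hxy hyz hzt hx hy hz ht
  · exact h3 C hC D hD hCD x y z t hxy hyz hzt hx hz hy ht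

theorem _root_.IsNonCrossing.mono {P P' : Finset (Finset ℕ)} (h : IsNonCrossing P) (hP : P' ⊆ P) :
    IsNonCrossing P' :=
  fun C hC D hD => h C (hP hC) D (hP hD)

theorem erase_first (hp : IsPointedNC a n B Q) (haB : a + 1 ∈ B) :
    IsPointedNC (a + 1) n (B.erase a) Q where
  mem := by simp [haB]
  block_subset x hx := by
    obtain ⟨hxa, hx⟩ := Finset.mem_erase.1 hx
    have := hp.block_subset x hx
    omega
  subset C hC x hx := by
    have h1 := hp.subset C hC x hx
    have h2 : x ≠ a := by rintro rfl; exact hp.notMem_block C hC x hx hp.mem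
    omega
  nonempty := hp.nonempty
  notMem_block C hC x hx hxB := hp.notMem_block C hC x hx (Finset.mem_of_mem_erase hxB)
  eq_of_mem := hp.eq_of_mem
  cover x hx hxn := by
    rcases hp.cover x (by omega) hxn with h | h
    · exact Or.inl (Finset.mem_erase.2 ⟨by omega, h⟩)
    · exact Or.inr h
  nonCrossing := by
    refine isNonCrossing_insert ?_ ?_ (hp.nonCrossing.mono (Finset.subset_insert _ _))
    · intro C hC x y z t hxy hyz hzt hx hy hz
      exact hp.not_crossing_block hC hxy hyz hzt (Finset.mem_of_mem_erase hx) hy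
        (Finset.mem_of_mem_erase hz)
    · intro C hC x y z t hxy hyz hzt hx hy hz ht
      exact hp.not_crossing_block' hC hxy hyz hzt hx (Finset.mem_of_mem_erase hy) hz
        (Finset.mem_of_mem_erase ht)

theorem merge_block (hp : IsPointedNC a n B Q) {D : Finset ℕ} (hD : D ∈ Q) (haD : a + 1 ∈ D) :
    IsPointedNC (a + 1) n (B.erase a ∪ D) (Q.erase D) where
  mem := by simp [haD]
  block_subset x hx := by
    rcases Finset.mem_union.1 hx with hx | hx
    · obtain ⟨hxa, hx⟩ := Finset.mem_erase.1 hx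
      have := hp.block_subset x hx
      omega
    · have h1 := hp.subset D hD x hx
      have h2 : x ≠ a := fun h => hp.notMem_block D hD x hx (h ▸ hp.mem)
      omega
  subset C hC x hx := by
    have hC := Finset.mem_of_mem_erase hC
    have h1 := hp.subset C hC x hx
    have h2 : x ≠ a := by rintro rfl; exact hp.notMem_block C hC x hx hp.mem
    omega
  nonempty C hC := hp.nonempty C (Finset.mem_of_mem_erase hC)
  notMem_block C hC x hx hxB := by
    obtain ⟨hCD, hC⟩ := Finset.mem_erase.1 hC
    rcases Finset.mem_union.1 hxB with h | h
    · exact hp.notMem_block C hC x hx (Finset.mem_of_mem_erase h)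
    · exact hCD (hp.eq_of_mem C hC D hD x hx h)
  eq_of_mem C hC E hE :=
    hp.eq_of_mem C (Finset.mem_of_mem_erase hC) E (Finset.mem_of_mem_erase hE)
  cover x hx hxn := by
    rcases hp.cover x (by omega) hxn with h | ⟨C, hC, hxC⟩
    · exact Or.inl (Finset.mem_union_left _ (Finset.mem_erase.2 ⟨by omega, h⟩))
    · by_cases hCD : C = D
      · exact Or.inl (Finset.mem_union_right _ (hCD ▸ hxC))
      · exact Or.inr ⟨C, Finset.mem_erase.2 ⟨hCD, hC⟩, hxC⟩
  nonCrossing := by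
    refine isNonCrossing_insert ?_ ?_
      (hp.nonCrossing.mono ((Finset.erase_subset _ _).trans (Finset.subset_insert _ _)))
    · intro C hC x y z t hxy hyz hzt hx hy hz ht
      obtain ⟨hCD, hC⟩ := Finset.mem_erase.1 hC
      have hax : a + 1 ≤ x := by
        rcases Finset.mem_union.1 hx with h | h
        · exact (hp.lt_of_mem_of_mem hD haD haD h).le
        · have h1 := hp.subset D hD x h
          have h2 : x ≠ a := by rintro rfl; exact hp.notMem_block D hD x h hp.mem
          omega
      rcases Finset.mem_union.1 hz with h | h
      · exact hp.not_crossing_block hC (x := a) (by omega) hyz hzt hp.mem hy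
          (Finset.mem_of_mem_erase h) ht
      · exact hp.not_crossing hD hC (Ne.symm hCD) (x := a + 1) (by omega) hyz hzt haD hy h ht
    · intro C hC x y z t hxy hyz hzt hx hy hz ht
      obtain ⟨hCD, hC⟩ := Finset.mem_erase.1 hC
      have hax : a + 1 < x := by
        have h1 := hp.subset C hC x hx
        have h2 : x ≠ a := by rintro rfl; exact hp.notMem_block C hC x hx hp.mem
        have h3 : x ≠ a + 1 := by rintro rfl; exact hCD (hp.eq_of_mem C hC D hD _ hx haD)
        omega
      rcases Finset.mem_union.1 hy with h | h
      · rcases Finset.mem_union.1 ht with h' | h'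
        · exact hp.not_crossing_block' hC hxy hyz hzt hx (Finset.mem_of_mem_erase h) hz
            (Finset.mem_of_mem_erase h')
        · exact absurd (hp.lt_of_mem_of_mem hD haD h' h) (by omega)
      · exact hp.not_crossing hD hC (Ne.symm hCD) hax hxy hyz haD hx h hz

theorem insert_first (hp : IsPointedNC (a + 1) n B Q) :
    IsPointedNC a n (insert a B) Q where
  mem := Finset.mem_insert_self _ _
  block_subset x hx := by
    have h1 := hp.block_subset _ hp.mem
    rcases Finset.mem_insert.1 hx with rfl | hx
    · omega
    · have := hp.block_subset x hx
      omega
  subset C hC x hx := by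
    have h1 := hp.subset C hC x hx
    omega
  nonempty := hp.nonempty
  notMem_block C hC x hx hxB := by
    rcases Finset.mem_insert.1 hxB with rfl | h
    · have := hp.subset C hC x hx
      omega
    · exact hp.notMem_block C hC x hx h
  eq_of_mem := hp.eq_of_mem
  cover x hx hxn := by
    rcases hx.eq_or_lt with rfl | hx
    · exact Or.inl (Finset.mem_insert_self _ _)
    · rcases hp.cover x hx hxn with h | h
      · exact Or.inl (Finset.mem_insert_of_mem h)
      · exact Or.inr h
  nonCrossing := by
    refine isNonCrossing_insert ?_ ?_ (hp.nonCrossing.mono (Finset.subset_insert _ _))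
    · intro C hC x y z t hxy hyz hzt hx hy hz ht
      have h1 := hp.subset C hC y hy
      have h2 : y ≠ a + 1 := by rintro rfl; exact hp.notMem_block C hC _ hy hp.mem
      have hz : z ∈ B := (Finset.mem_insert.1 hz).resolve_left (by omega)
      exact hp.not_crossing_block hC (x := a + 1) (by omega) hyz hzt hp.mem hy hz ht
    · intro C hC x y z t hxy hyz hzt hx hy hz ht
      have h1 := hp.subset C hC x hx
      have hy : y ∈ B := (Finset.mem_insert.1 hy).resolve_left (by omega)
      have ht : t ∈ B := (Finset.mem_insert.1 ht).resolve_left (by omega)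
      exact hp.not_crossing_block' hC hxy hyz hzt hx hy hz ht

theorem split_block {U D : Finset ℕ} (hp : IsPointedNC (a + 1) n B Q) (hB : U ∪ D = B)
    (hlt : ∀ x ∈ D, ∀ y ∈ U, x < y) (hD : D.Nonempty) :
    IsPointedNC a n (insert a U) (insert D Q) := by
  have hUB : U ⊆ B := hB ▸ Finset.subset_union_left
  have hDB : D ⊆ B := hB ▸ Finset.subset_union_right
  have hq := hp.insert_first
  have hDQ : ∀ C ∈ Q, ∀ x ∈ C, x ∉ D := fun C hC x hx hxD => hp.notMem_block C hC x hx (hDB hxD)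
  have hUa : insert a U ⊆ insert a B := Finset.insert_subset_insert _ hUB
  refine ⟨Finset.mem_insert_self _ _, fun x hx => hq.block_subset x (hUa hx),
    ?_, ?_, ?_, ?_, ?_, ?_⟩
  · intro C hC x hx
    rcases Finset.mem_insert.1 hC with rfl | hC
    · exact hq.block_subset x (Finset.mem_insert_of_mem (hDB hx))
    · exact hq.subset C hC x hx
  · intro C hC
    rcases Finset.mem_insert.1 hC with rfl | hC
    · exact hD
    · exact hp.nonempty C hC
  · intro C hC x hx hxU
    rcases Finset.mem_insert.1 hC with rfl | hC
    · rcases Finset.mem_insert.1 hxU with rfl | hxU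
      · have := hp.block_subset x (hDB hx)
        omega
      · exact (hlt x hx x hxU).false
    · exact hq.notMem_block C hC x hx (hUa hxU)
  · intro C hC E hE x hxC hxE
    rcases Finset.mem_insert.1 hC with hCD | hCQ <;> rcases Finset.mem_insert.1 hE with hED | hEQ
    · rw [hCD, hED]
    · exact (hDQ E hEQ x hxE (hCD ▸ hxC)).elim
    · exact (hDQ C hCQ x hxC (hED ▸ hxE)).elim
    · exact hp.eq_of_mem C hCQ E hEQ x hxC hxE
  · intro x hx hxn
    rcases hq.cover x hx hxn with h | ⟨C, hC, h⟩
    · rw [← hB, ← Finset.insert_union, Finset.mem_union] at h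
      exact h.imp_right fun h => ⟨D, Finset.mem_insert_self _ _, h⟩
    · exact Or.inr ⟨C, Finset.mem_insert_of_mem hC, h⟩
  · refine isNonCrossing_insert ?_ ?_ (isNonCrossing_insert ?_ ?_
      (hp.nonCrossing.mono (Finset.subset_insert _ _)))
    · intro C hC x y z t hxy hyz hzt hx hy hz ht
      rcases Finset.mem_insert.1 hC with rfl | hC
      · have := hp.block_subset y (hDB hy)
        have hz : z ∈ U := (Finset.mem_insert.1 hz).resolve_left (by omega)
        exact absurd (hlt t ht z hz) (by omega)
      · exact hq.not_crossing_block hC hxy hyz hzt (hUa hx) hy (hUa hz) ht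
    · intro C hC x y z t hxy hyz hzt hx hy hz ht
      rcases Finset.mem_insert.1 hC with rfl | hC
      · have := hp.block_subset x (hDB hx)
        have hy : y ∈ U := (Finset.mem_insert.1 hy).resolve_left (by omega)
        exact absurd (hlt z hz y hy) (by omega)
      · exact hq.not_crossing_block' hC hxy hyz hzt hx (hUa hy) hz (hUa ht)
    · intro C hC x y z t hxy hyz hzt hx hy hz
      exact hp.not_crossing_block hC hxy hyz hzt (hDB hx) hy (hDB hz)
    · intro C hC x y z t hxy hyz hzt hx hy hz ht
      exact hp.not_crossing_block' hC hxy hyz hzt hx (hDB hy) hz (hDB ht)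

theorem isPointedNC_mergeFirst (hp : IsPointedNC a n B Q) (han : a < n) :
    IsPointedNC (a + 1) n (mergeFirst a (B, Q)).1 (mergeFirst a (B, Q)).2 := by
  rcases hp.cover (a + 1) (by omega) han with h | ⟨D, hD, h⟩
  · rw [hp.mergeFirst_eq_of_mem_block h]
    exact hp.erase_first h
  · rw [hp.mergeFirst_eq_of_mem hD h]
    exact hp.merge_block hD h

theorem isPointedNC_splitFirst (hp : IsPointedNC (a + 1) n B Q) {h : ℕ} (hh : h ≤ B.card) :
    IsPointedNC a n (splitFirst a h (B, Q)).1 (splitFirst a h (B, Q)).2 := by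
  have hcard := card_topElems h B
  rw [min_eq_left hh] at hcard
  unfold splitFirst
  dsimp only
  split_ifs with hB
  · rw [Finset.eq_of_subset_of_card_le (topElems_subset h B) (by omega)]
    exact hp.insert_first
  · refine hp.split_block (Finset.union_sdiff_of_subset (topElems_subset h B)) ?_ ?_
    · intro x hx y hy
      rw [Finset.mem_sdiff] at hx
      by_contra! hxy
      rcases hxy.eq_or_lt with rfl | hxy
      · exact hx.2 hy
      · exact hx.2 (mem_topElems_of_lt hy hx.1 hxy)
    · rw [Finset.sdiff_nonempty]
      intro hs
      have := Finset.card_le_card hs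
      omega

theorem mergeFirst_splitFirst (hp : IsPointedNC (a + 1) n B Q) {h : ℕ} (hh : h ≤ B.card) :
    mergeFirst a (splitFirst a h (B, Q)) = (B, Q) := by
  have hq := hp.isPointedNC_splitFirst hh
  have haB : a ∉ B := fun haB => by
    have := hp.block_subset a haB
    omega
  have haT : a ∉ topElems h B := fun h' => haB (topElems_subset h B h')
  have hcard := card_topElems h B
  rw [min_eq_left hh] at hcard
  unfold splitFirst at hq ⊢
  dsimp only at hq ⊢
  split_ifs at hq ⊢ with hB
  · rw [Finset.eq_of_subset_of_card_le (topElems_subset h B) (by omega)] at hq ⊢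
    rw [hq.mergeFirst_eq_of_mem_block (Finset.mem_insert_of_mem hp.mem),
      Finset.erase_insert haB]
  · have haD : a + 1 ∈ B \ topElems h B := by
      refine Finset.mem_sdiff.2 ⟨hp.mem, fun hT => ?_⟩
      have hs : B ⊆ topElems h B := fun x hx => by
        rcases (hp.block_subset x hx).1.eq_or_lt with rfl | hlt
        · exact hT
        · exact mem_topElems_of_lt hT hx hlt
      have := Finset.card_le_card hs
      omega
    have hDQ : B \ topElems h B ∉ Q := fun hD =>
      hp.notMem_block _ hD _ haD hp.mem
    rw [hq.mergeFirst_eq_of_mem (Finset.mem_insert_self _ _) haD, Finset.erase_insert haT,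
      Finset.erase_insert hDQ, Finset.union_sdiff_of_subset (topElems_subset h B)]

theorem topElems_merge (hp : IsPointedNC a n B Q) {D : Finset ℕ} (hD : D ∈ Q) (haD : a + 1 ∈ D) :
    topElems (B.card - 1) (B.erase a ∪ D) = B.erase a := by
  rw [← Finset.card_erase_of_mem hp.mem]
  exact topElems_union_eq fun x hx y hy => hp.lt_of_mem_of_mem hD haD hx hy

theorem disjoint_erase (hp : IsPointedNC a n B Q) {D : Finset ℕ} (hD : D ∈ Q) :
    Disjoint (B.erase a) D :=
  Finset.disjoint_left.2 fun x hx hxD => hp.notMem_block D hD x hxD (Finset.mem_of_mem_erase hx)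

theorem splitFirst_mergeFirst (hp : IsPointedNC a n B Q) (han : a < n) :
    splitFirst a (B.card - 1) (mergeFirst a (B, Q)) = (B, Q) := by
  have hcard := Finset.card_erase_of_mem hp.mem
  rcases hp.cover (a + 1) (by omega) han with h | ⟨D, hD, h⟩
  · rw [hp.mergeFirst_eq_of_mem_block h]
    unfold splitFirst
    have hT : topElems (B.card - 1) (B.erase a) = B.erase a :=
      Finset.eq_of_subset_of_card_le (topElems_subset _ _) (by rw [card_topElems]; omega)
    simp only [hT, hcard, Finset.insert_erase hp.mem, if_true]
  · rw [hp.mergeFirst_eq_of_mem hD h]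
    unfold splitFirst
    have hDpos : 0 < D.card := Finset.card_pos.2 (hp.nonempty D hD)
    have hne : (B.erase a ∪ D).card ≠ B.card - 1 := by
      rw [Finset.card_union_of_disjoint (hp.disjoint_erase hD)]
      omega
    simp only [hp.topElems_merge hD h, if_neg hne, Finset.insert_erase hp.mem]
    rw [Finset.union_sdiff_cancel_left (hp.disjoint_erase hD), Finset.insert_erase hD]

theorem card_le_card_mergeFirst (hp : IsPointedNC a n B Q) :
    B.card - 1 ≤ (mergeFirst a (B, Q)).1.card := by
  rw [← Finset.card_erase_of_mem hp.mem]
  exact Finset.card_le_card Finset.subset_union_left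

theorem card_splitFirst (hp : IsPointedNC (a + 1) n B Q) {h : ℕ} (hh : h ≤ B.card) :
    (splitFirst a h (B, Q)).1.card = h + 1 := by
  have haT : a ∉ topElems h B := fun h' => by
    have := hp.block_subset a (topElems_subset h B h')
    omega
  unfold splitFirst
  rw [Finset.card_insert_of_notMem haT, card_topElems, min_eq_left hh]

theorem prod_splitFirst (hp : IsPointedNC (a + 1) n B Q) {h : ℕ} (hh : h ≤ B.card)
    {w : ℕ → ℝ≥0∞} (hw : w 0 = 1) :
    ∏ C ∈ (splitFirst a h (B, Q)).2, w C.card = w (B.card - h) * ∏ C ∈ Q, w C.card := by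
  have hcard := card_topElems h B
  rw [min_eq_left hh] at hcard
  unfold splitFirst
  dsimp only
  split_ifs with hB
  · rw [hB, Nat.sub_self, hw, one_mul]
  · have hDQ : B \ topElems h B ∉ Q := fun hD => by
      obtain ⟨x, hx⟩ := hp.nonempty _ hD
      exact hp.notMem_block _ hD x hx (Finset.mem_sdiff.1 hx).1
    rw [Finset.prod_insert hDQ, Finset.card_sdiff_of_subset (topElems_subset h B), hcard]

end IsPointedNC

/-- The finite set of pairs satisfying `IsPointedNC a n`. -/
noncomputable def pointedNC (a n : ℕ) : Finset (Finset ℕ × Finset (Finset ℕ)) :=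
  ((Finset.Icc a n).powerset ×ˢ (Finset.Icc a n).powerset.powerset).filter
    fun p => IsPointedNC a n p.1 p.2

theorem mem_pointedNC {a n : ℕ} {p : Finset ℕ × Finset (Finset ℕ)} :
    p ∈ pointedNC a n ↔ IsPointedNC a n p.1 p.2 := by
  rw [pointedNC, Finset.mem_filter, and_iff_right_iff_imp]
  intro hp
  rw [Finset.mem_product, Finset.mem_powerset, Finset.mem_powerset]
  exact ⟨fun x hx => Finset.mem_Icc.2 (hp.block_subset x hx), fun C hC =>
    Finset.mem_powerset.2 fun x hx => Finset.mem_Icc.2 (hp.subset C hC x hx)⟩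

theorem sum_pointedNC_succ {w : ℕ → ℝ≥0∞} (hw : w 0 = 1) {a n : ℕ} (han : a < n) (h : ℕ) :
    ∑ p ∈ (pointedNC a n).filter (fun p => p.1.card = h + 1), ∏ C ∈ p.2, w C.card =
      ∑ p ∈ (pointedNC (a + 1) n).filter (fun p => h ≤ p.1.card),
        w (p.1.card - h) * ∏ C ∈ p.2, w C.card := by
  symm
  refine Finset.sum_nbij' (splitFirst a h) (mergeFirst a) ?_ ?_ ?_ ?_ ?_
  · rintro ⟨B, Q⟩ hp
    rw [Finset.mem_filter, mem_pointedNC] at hp ⊢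
    exact ⟨hp.1.isPointedNC_splitFirst hp.2, hp.1.card_splitFirst hp.2⟩
  · rintro ⟨B, Q⟩ hp
    rw [Finset.mem_filter, mem_pointedNC] at hp ⊢
    have hle := hp.1.card_le_card_mergeFirst
    have hB : B.card = h + 1 := hp.2
    rw [hB] at hle
    exact ⟨hp.1.isPointedNC_mergeFirst han, hle⟩
  · rintro ⟨B, Q⟩ hp
    rw [Finset.mem_filter, mem_pointedNC] at hp
    exact hp.1.mergeFirst_splitFirst hp.2
  · rintro ⟨B, Q⟩ hp
    rw [Finset.mem_filter, mem_pointedNC] at hp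
    have := hp.1.splitFirst_mergeFirst han
    rwa [show B.card - 1 = h by simp only at hp; omega] at this
  · rintro ⟨B, Q⟩ hp
    rw [Finset.mem_filter, mem_pointedNC] at hp
    exact (hp.1.prod_splitFirst hp.2 hw).symm

theorem pointedNC_self (n : ℕ) : pointedNC n n = {({n}, ∅)} := by
  ext ⟨B, Q⟩
  rw [mem_pointedNC, Finset.mem_singleton, Prod.mk.injEq]
  dsimp only
  constructor
  · intro hp
    have hB : B = {n} := Finset.eq_singleton_iff_unique_mem.2
      ⟨hp.mem, fun x hx => by have := hp.block_subset x hx; omega⟩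
    refine ⟨hB, Finset.eq_empty_of_forall_notMem fun C hC => ?_⟩
    obtain ⟨x, hx⟩ := hp.nonempty C hC
    have := hp.subset C hC x hx
    obtain rfl : x = n := by omega
    exact hp.notMem_block C hC x hx hp.mem
  · rintro ⟨rfl, rfl⟩
    refine ⟨by simp, by simp, by simp, by simp, by simp, by simp, fun x h1 h2 => ?_, ?_⟩
    · left
      rw [Finset.mem_singleton]
      omega
    · intro C hC D hD hCD
      simp only [insert_empty_eq, Finset.mem_singleton] at hC hD
      exact (hCD (hC.trans hD.symm)).elim

theorem sum_pointedNC {w : ℕ → ℝ≥0∞} (hw : w 0 = 1) (a d h : ℕ) :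
    ∑ p ∈ (pointedNC a (a + d)).filter (fun p => p.1.card = h + 1), ∏ C ∈ p.2, w C.card =
      lukCount w d h := by
  induction d generalizing a h with
  | zero =>
    rw [add_zero, pointedNC_self, Finset.filter_singleton]
    cases h <;> simp [lukCount]
  | succ d ih =>
    rw [sum_pointedNC_succ hw (by omega)]
    have key : ∀ i₀ : ℕ, h ≤ i₀ + 1 → (∀ j, 1 ≤ j → h ≤ j → i₀ + 1 ≤ j) →
        ∑ p ∈ (pointedNC (a + 1) (a + (d + 1))).filter (fun p => h ≤ p.1.card),
          w (p.1.card - h) * ∏ C ∈ p.2, w C.card =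
        ∑' i, w (i₀ + i + 1 - h) * lukCount w d (i₀ + i) := by
      intro i₀ hi₀ hmin
      simp_rw [← ih (a + 1), Finset.mul_sum, Finset.sum_filter]
      rw [Summable.tsum_finsetSum fun _ _ => ENNReal.summable,
        show a + (d + 1) = a + 1 + d by ring]
      refine Finset.sum_congr rfl fun p hp => ?_
      rw [mem_pointedNC] at hp
      have hpos : 1 ≤ p.1.card := Finset.card_pos.2 ⟨_, hp.mem⟩
      split_ifs with hhp
      · have := hmin _ hpos hhp
        rw [tsum_eq_single (p.1.card - 1 - i₀), if_pos (by omega)]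
        · congr 2
          omega
        · intro i hi
          rw [if_neg (by omega)]
      · symm
        rw [ENNReal.tsum_eq_zero]
        intro i
        rw [if_neg (by omega)]
    cases h with
    | zero =>
      rw [key 0 (by omega) (fun j h1 h2 => by omega), lukCount.eq_3]
      simp
    | succ h =>
      rw [key h (by omega) (fun j h1 h2 => by omega), lukCount.eq_4]
      refine tsum_congr fun i => ?_
      rw [show h + i + 1 - (h + 1) = i by omega]

/-- The weighted enumeration of non-crossing partitions of `[n]` by Łukasiewicz words. -/
theorem sum_NCP {w : ℕ → ℝ≥0∞} (hw : w 0 = 1) (n : ℕ) :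
    ∑ P ∈ NCP n, ∏ B ∈ P, w B.card = lukCount w n 0 := by
  cases n with
  | zero =>
    have : NCP 0 = {∅} := by
      ext P
      simp only [NCP, Finset.mem_filter, Finset.mem_singleton, Finset.mem_powerset]
      constructor
      · rintro ⟨-, hP, -⟩
        refine Finset.eq_empty_of_forall_notMem fun B hB => ?_
        obtain ⟨h1, x, hx⟩ := hP.1 B hB
        simpa using h1 hx
      · rintro rfl
        simp [IsPartitionOf, IsNonCrossing]
    simp [this, lukCount]
  | succ n =>
    have h1 : ∑ P ∈ NCP (n + 1), ∏ B ∈ P, w B.card =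
        ∑ p ∈ pointedNC 1 (1 + n), w p.1.card * ∏ C ∈ p.2, w C.card := by
      rw [add_comm n 1]
      symm
      refine Finset.sum_bij (fun p _ => insert p.1 p.2) ?_ ?_ ?_ ?_
      · rintro ⟨B, Q⟩ hp
        rw [mem_pointedNC] at hp
        simp only at hp ⊢
        have hsub : ∀ C ∈ insert B Q, C ⊆ Finset.Icc 1 (1 + n) ∧ C.Nonempty := by
          intro C hC
          rcases Finset.mem_insert.1 hC with rfl | hC
          · exact ⟨fun x hx => Finset.mem_Icc.2 (hp.block_subset x hx), 1, hp.mem⟩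
          · exact ⟨fun x hx => Finset.mem_Icc.2 (hp.subset C hC x hx), hp.nonempty C hC⟩
        rw [NCP, Finset.mem_filter, Finset.mem_powerset]
        refine ⟨fun C hC => Finset.mem_powerset.2 (hsub C hC).1, ⟨hsub, fun x hx => ?_⟩,
          hp.nonCrossing⟩
        rw [Finset.mem_Icc] at hx
        rcases hp.cover x hx.1 hx.2 with h | ⟨C, hC, h⟩
        · refine ⟨B, ⟨Finset.mem_insert_self _ _, h⟩, ?_⟩
          rintro D ⟨hD, hxD⟩
          exact (Finset.mem_insert.1 hD).resolve_right fun hD => hp.notMem_block D hD x hxD h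
        · refine ⟨C, ⟨Finset.mem_insert_of_mem hC, h⟩, ?_⟩
          rintro D ⟨hD, hxD⟩
          rcases Finset.mem_insert.1 hD with rfl | hD
          · exact (hp.notMem_block C hC x h hxD).elim
          · exact hp.eq_of_mem D hD C hC x hxD h
      · rintro ⟨B, Q⟩ hp ⟨B', Q'⟩ hp' heq
        rw [mem_pointedNC] at hp hp'
        simp only at hp hp' heq
        have hB : B = B' := by
          have : B ∈ insert B' Q' := heq ▸ Finset.mem_insert_self _ _
          exact (Finset.mem_insert.1 this).resolve_right
            fun h => hp'.notMem_block B h 1 hp.mem hp'.mem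
        subst hB
        rw [← Finset.erase_insert hp.block_notMem, heq, Finset.erase_insert hp'.block_notMem]
      · intro P hP
        rw [NCP, Finset.mem_filter] at hP
        obtain ⟨-, ⟨hsub, hex⟩, hnc⟩ := hP
        obtain ⟨B, ⟨hB, h1B⟩, -⟩ := hex 1 (Finset.mem_Icc.2 ⟨le_rfl, by omega⟩)
        have huniq : ∀ C ∈ P, ∀ D ∈ P, ∀ x, x ∈ C → x ∈ D → C = D := fun C hC D hD x hxC hxD =>
          (hex x ((hsub C hC).1 hxC)).unique ⟨hC, hxC⟩ ⟨hD, hxD⟩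
        refine ⟨(B, P.erase B), mem_pointedNC.2 ⟨h1B, ?_, ?_, ?_, ?_, ?_, ?_, ?_⟩,
          Finset.insert_erase hB⟩
        · exact fun x hx => Finset.mem_Icc.1 ((hsub B hB).1 hx)
        · exact fun C hC x hx => Finset.mem_Icc.1 ((hsub C (Finset.mem_of_mem_erase hC)).1 hx)
        · exact fun C hC => (hsub C (Finset.mem_of_mem_erase hC)).2
        · intro C hC x hx hxB
          exact Finset.ne_of_mem_erase hC (huniq C (Finset.mem_of_mem_erase hC) B hB x hx hxB)
        · exact fun C hC D hD =>
            huniq C (Finset.mem_of_mem_erase hC) D (Finset.mem_of_mem_erase hD)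
        · intro x hx hxn
          obtain ⟨C, ⟨hC, hxC⟩, -⟩ := hex x (Finset.mem_Icc.2 ⟨hx, hxn⟩)
          by_cases hCB : C = B
          · exact Or.inl (hCB ▸ hxC)
          · exact Or.inr ⟨C, Finset.mem_erase.2 ⟨hCB, hC⟩, hxC⟩
        · rwa [Finset.insert_erase hB]
      · rintro ⟨B, Q⟩ hp
        rw [mem_pointedNC] at hp
        simp only
        rw [Finset.prod_insert hp.block_notMem]
    rw [h1, lukCount.eq_3]
    simp_rw [← sum_pointedNC hw 1, Finset.mul_sum, Finset.sum_filter]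
    rw [Summable.tsum_finsetSum fun _ _ => ENNReal.summable]
    refine Finset.sum_congr rfl fun p hp => ?_
    rw [mem_pointedNC] at hp
    have hpos : 1 ≤ p.1.card := Finset.card_pos.2 ⟨_, hp.mem⟩
    rw [tsum_eq_single (p.1.card - 1), if_pos (by omega), Nat.sub_add_cancel hpos]
    intro i hi
    rw [if_neg (by omega)]

/-- The weight `exp (f i)` for `i ∈ A`, extended by `1` at `0` and by `0` elsewhere. -/
noncomputable def expWeight (A : Set ℕ) (f : ℕ → ℝ) (i : ℕ) : ℝ≥0∞ :=
  if i = 0 then 1 else if i ∈ A then ENNReal.ofReal (Real.exp (f i)) else 0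

theorem expWeight_zero (A : Set ℕ) (f : ℕ → ℝ) : expWeight A f 0 = 1 := if_pos rfl

theorem sum_NCPA (A : Set ℕ) (f : ℕ → ℝ) (n : ℕ) :
    ∑ P ∈ NCPA A n, ENNReal.ofReal (Real.exp (∑ B ∈ P, f B.card)) =
      lukCount (expWeight A f) n 0 := by
  rw [← sum_NCP (expWeight_zero A f), NCPA, Finset.sum_filter]
  refine Finset.sum_congr rfl fun P hP => ?_
  rw [NCP, Finset.mem_filter] at hP
  have h0 : ∀ B ∈ P, B.card ≠ 0 := fun B hB => (Finset.card_pos.2 (hP.2.1.1 B hB).2).ne'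
  split_ifs with hA
  · rw [Real.exp_sum, ENNReal.ofReal_prod_of_nonneg fun _ _ => (Real.exp_pos _).le]
    exact Finset.prod_congr rfl fun B hB => by
      rw [expWeight, if_neg (h0 B hB), if_pos (hA B hB)]
  · push Not at hA
    obtain ⟨B, hB, hBA⟩ := hA
    rw [eq_comm, Finset.prod_eq_zero hB]
    rw [expWeight, if_neg (h0 B hB), if_neg hBA]

theorem card_NCPA (A : Set ℕ) (n : ℕ) :
    ((NCPA A n).card : ℝ≥0∞) = lukCount (expWeight A 0) n 0 := by
  simp [← sum_NCPA]

theorem tsum_expWeight {A : Set ℕ} (hA : 0 ∉ A) (f : ℕ → ℝ) {b : ℕ → ℝ} (hb : ∀ i, 0 ≤ b i)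
    (hs : Summable fun i : A => Real.exp (f i) * b i) :
    ∑' i, expWeight A f i * ENNReal.ofReal (b i) =
      ENNReal.ofReal (b 0 + ∑' i : A, Real.exp (f i) * b i) := by
  have hnn : ∀ i, 0 ≤ Real.exp (f i) * b i := fun i => mul_nonneg (Real.exp_pos _).le (hb i)
  rw [ENNReal.ofReal_add (hb 0) (tsum_nonneg fun _ => hnn _),
    ENNReal.ofReal_tsum_of_nonneg (fun _ => hnn _) hs,
    tsum_subtype A fun i => ENNReal.ofReal (Real.exp (f i) * b i),
    ENNReal.tsum_eq_add_tsum_ite 0, expWeight_zero, one_mul]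
  congr 1
  refine tsum_congr fun i => ?_
  by_cases hi : i = 0
  · subst hi
    rw [if_pos rfl, Set.indicator_of_notMem hA]
  · rw [if_neg hi, expWeight, if_neg hi]
    split_ifs with hiA
    · rw [Set.indicator_of_mem hiA, ENNReal.ofReal_mul (Real.exp_pos _).le]
    · rw [Set.indicator_of_notMem hiA, zero_mul]

/-- First-order expansion of an exponential moment: a negative drift lowers it. -/
theorem exists_tsum_exp_lt {ι : Type*} {b g : ι → ℝ} (hb : ∀ i, 0 ≤ b i) (hs : Summable b)
    {M : ℝ} (hM : 0 < M) (hg : ∀ i, |g i| ≤ M) (hneg : ∑' i, g i * b i < 0) :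
    ∃ s : ℝ, 0 < s ∧ (Summable fun i => Real.exp (s * g i) * b i) ∧
      ∑' i, Real.exp (s * g i) * b i < ∑' i, b i := by
  set G := ∑' i, g i * b i with hG
  set c := M ^ 2 * ∑' i, b i with hc
  have hc0 : 0 ≤ c := mul_nonneg (sq_nonneg M) (tsum_nonneg hb)
  have hgs : Summable fun i => g i * b i :=
    Summable.of_norm_bounded (hs.mul_left M) fun i => by
      rw [Real.norm_eq_abs, abs_mul, abs_of_nonneg (hb i)]
      exact mul_le_mul_of_nonneg_right (hg i) (hb i)
  set s := min (1 / M) (-G / (c + 1)) with hsdef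
  have hs0 : 0 < s := lt_min (by positivity) (div_pos (by linarith) (by linarith))
  have hsM : s * M ≤ 1 := by
    have : s ≤ 1 / M := min_le_left _ _
    rwa [le_div_iff₀ hM] at this
  have hsc : s * (c + 1) ≤ -G := by
    have : s ≤ -G / (c + 1) := min_le_right _ _
    rwa [le_div_iff₀ (by linarith)] at this
  have hexp : ∀ i, Real.exp (s * g i) * b i ≤ b i + s * (g i * b i) + s ^ 2 * M ^ 2 * b i := by
    intro i
    have habs : |s * g i| ≤ s * M := by
      rw [abs_mul, abs_of_pos hs0]
      exact mul_le_mul_of_nonneg_left (hg i) hs0.le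
    have h1 := (abs_le.1 (Real.abs_exp_sub_one_sub_id_le (habs.trans hsM))).2
    have h2 : (s * g i) ^ 2 ≤ (s * M) ^ 2 := sq_le_sq' (by linarith [(abs_le.1 habs).1])
      (abs_le.1 habs).2
    calc Real.exp (s * g i) * b i ≤ (1 + s * g i + s ^ 2 * M ^ 2) * b i :=
          mul_le_mul_of_nonneg_right (by nlinarith) (hb i)
      _ = _ := by ring
  have hbs := (hs.add (hgs.mul_left s)).add (hs.mul_left (s ^ 2 * M ^ 2))
  have hes : Summable fun i => Real.exp (s * g i) * b i :=
    hbs.of_nonneg_of_le (fun i => mul_nonneg (Real.exp_pos _).le (hb i)) hexp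
  refine ⟨s, hs0, hes, ?_⟩
  have hle := hes.tsum_le_tsum hexp hbs
  rw [(hs.add (hgs.mul_left s)).tsum_add (hs.mul_left _), hs.tsum_add (hgs.mul_left s),
    tsum_mul_left, tsum_mul_left, ← hG] at hle
  have : s * G + s ^ 2 * M ^ 2 * ∑' i, b i = s * (G + s * c) := by rw [hc]; ring
  have : s * (G + s * c) < 0 := mul_neg_of_pos_of_neg hs0 (by linarith)
  linarith

theorem summable_pow_of_summable_mul_pow {A : Set ℕ} (hApos : ∀ a ∈ A, 1 ≤ a) {ξ : ℝ}
    (hξpos : 0 < ξ) (hξsum : Summable fun i : A => (i : ℝ) * ξ ^ (i : ℕ)) :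
    Summable fun i : A => ξ ^ (i : ℕ) :=
  hξsum.of_nonneg_of_le (fun i => by positivity) fun i =>
    le_mul_of_one_le_left (by positivity) (by exact_mod_cast hApos i i.2)

theorem exists_mul_pow_le_card_NCPA {A : Set ℕ} (hApos : ∀ a ∈ A, 1 ≤ a) {ξ : ℝ} (hξpos : 0 < ξ)
    (hξsum : Summable fun i : A => (i : ℝ) * ξ ^ (i : ℕ))
    (hξeq : 1 + ∑' i : A, ξ ^ (i : ℕ) = ∑' i : A, (i : ℝ) * ξ ^ (i : ℕ))
    {ρ : ℝ} (hρ0 : 0 < ρ) (hρ : ρ * ξ < 1 + ∑' i : A, ξ ^ (i : ℕ)) :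
    ∃ K : ℝ, 0 < K ∧ ∀ n, (NCPA A n).Nonempty → K * ρ ^ n ≤ (NCPA A n).card := by
  have hA0 : 0 ∉ A := fun h => absurd (hApos 0 h) (by norm_num)
  have hs := summable_pow_of_summable_mul_pow hApos hξpos hξsum
  have h1 : ∑' i, expWeight A 0 i * ENNReal.ofReal ξ ^ i =
      ENNReal.ofReal (1 + ∑' i : A, ξ ^ (i : ℕ)) := by
    have := tsum_expWeight hA0 0 (b := fun i => ξ ^ i) (fun i => by positivity) (by simpa using hs)
    simpa [ENNReal.ofReal_pow hξpos.le] using this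
  have h2 : ∑' i, expWeight A 0 i * (i * ENNReal.ofReal ξ ^ i) =
      ENNReal.ofReal (1 + ∑' i : A, ξ ^ (i : ℕ)) := by
    have := tsum_expWeight hA0 0 (b := fun i => i * ξ ^ i) (fun i => by positivity)
      (by simpa using hξsum)
    rw [hξeq]
    simpa [ENNReal.ofReal_pow hξpos.le, ENNReal.ofReal_mul] using this
  obtain ⟨K, hK0, hK⟩ := exists_mul_pow_le_lukCount (expWeight_zero A 0)
    (u := ENNReal.ofReal ξ) (ρ := ENNReal.ofReal ρ) (by simpa using hξpos) ENNReal.ofReal_ne_top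
    (h1.trans h2.symm) (h1 ▸ ENNReal.ofReal_ne_top) (by simpa using hρ0) (by
      rw [h1, ← ENNReal.ofReal_div_of_pos hξpos]
      exact (ENNReal.ofReal_lt_ofReal_iff_of_nonneg hρ0.le).2 ((lt_div_iff₀ hξpos).2 hρ))
  have hmin : min K 1 ≠ ∞ := ne_top_of_le_ne_top ENNReal.one_ne_top (min_le_right _ _)
  refine ⟨(min K 1).toReal, ENNReal.toReal_pos (lt_min hK0 one_pos).ne' hmin, fun n hn => ?_⟩
  have h3 := hK n (by rw [← card_NCPA]; exact_mod_cast hn.card_pos.ne')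
  have h4 : min K 1 * ENNReal.ofReal ρ ^ n ≤ ((NCPA A n).card : ℝ≥0∞) := by
    rw [card_NCPA]
    exact (mul_le_mul_left (min_le_left _ _) _).trans h3
  have h5 := ENNReal.toReal_mono (ENNReal.natCast_ne_top _) h4
  rwa [ENNReal.toReal_mul, ENNReal.toReal_pow, ENNReal.toReal_ofReal hρ0.le,
    ENNReal.toReal_natCast] at h5

theorem card_filter_mul_pow_le {A : Set ℕ} (hApos : ∀ a ∈ A, 1 ≤ a) {ξ : ℝ} (hξpos : 0 < ξ)
    (f : ℕ → ℝ) (hs : Summable fun i : A => Real.exp (f i) * ξ ^ (i : ℕ)) (n : ℕ) :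
    (((NCPA A n).filter fun P => 0 ≤ ∑ B ∈ P, f B.card).card : ℝ) * ξ ^ n ≤
      (1 + ∑' i : A, Real.exp (f i) * ξ ^ (i : ℕ)) ^ n := by
  have hA0 : 0 ∉ A := fun h => absurd (hApos 0 h) (by norm_num)
  have h1 : ∑' i, expWeight A f i * ENNReal.ofReal ξ ^ i =
      ENNReal.ofReal (1 + ∑' i : A, Real.exp (f i) * ξ ^ (i : ℕ)) := by
    have := tsum_expWeight hA0 f (b := fun i => ξ ^ i) (fun i => by positivity) hs
    simpa [ENNReal.ofReal_pow hξpos.le] using this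
  have h2 := lukCount_mul_pow_le (expWeight A f) (ENNReal.ofReal ξ) n 0
  have h3 : (((NCPA A n).filter fun P => 0 ≤ ∑ B ∈ P, f B.card).card : ℝ≥0∞) ≤
      lukCount (expWeight A f) n 0 := by
    rw [← sum_NCPA, Finset.card_eq_sum_ones, Finset.sum_filter, Nat.cast_sum]
    refine Finset.sum_le_sum fun P _ => ?_
    split_ifs with h
    · rw [Nat.cast_one, ENNReal.one_le_ofReal]
      exact Real.one_le_exp h
    · simp
  have hnn : 0 ≤ 1 + ∑' i : A, Real.exp (f i) * ξ ^ (i : ℕ) :=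
    add_nonneg zero_le_one (tsum_nonneg fun i => by positivity)
  rw [h1, pow_zero, mul_one] at h2
  have h4 := ENNReal.toReal_mono (ENNReal.pow_ne_top ENNReal.ofReal_ne_top)
    ((mul_le_mul_left h3 _).trans h2)
  rwa [ENNReal.toReal_mul, ENNReal.toReal_pow, ENNReal.toReal_pow, ENNReal.toReal_ofReal hξpos.le,
    ENNReal.toReal_ofReal hnn, ENNReal.toReal_natCast] at h4

/-- If `g` has negative mean under `π_A` (with `g 0 = 0`), then its sum over the blocks of a uniform
random element of `NCPA A n` is negative with probability tending to one. -/
theorem tendsto_card_filter_div_card {A : Set ℕ} (hApos : ∀ a ∈ A, 1 ≤ a) {ξ : ℝ} (hξpos : 0 < ξ)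
    (hξsum : Summable fun i : A => (i : ℝ) * ξ ^ (i : ℕ))
    (hξeq : 1 + ∑' i : A, ξ ^ (i : ℕ) = ∑' i : A, (i : ℝ) * ξ ^ (i : ℕ))
    {g : ℕ → ℝ} {M : ℝ} (hM : 0 < M) (hg : ∀ i, |g i| ≤ M)
    (hneg : ∑' i : A, g i * ξ ^ (i : ℕ) < 0) :
    Filter.Tendsto
      (fun n => (((NCPA A n).filter fun P => 0 ≤ ∑ B ∈ P, g B.card).card : ℝ) / (NCPA A n).card)
      (Filter.atTop ⊓ Filter.principal {n : ℕ | (NCPA A n).Nonempty}) (nhds 0) := by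
  obtain ⟨s, hs0, hes, hlt⟩ := exists_tsum_exp_lt (b := fun i : A => ξ ^ (i : ℕ))
    (g := fun i : A => g i) (fun i => by positivity)
    (summable_pow_of_summable_mul_pow hApos hξpos hξsum) hM (fun i => hg i) hneg
  set Ψ := 1 + ∑' i : A, Real.exp (s * g i) * ξ ^ (i : ℕ) with hΨ
  have hΨ1 : 1 ≤ Ψ := le_add_of_nonneg_right (tsum_nonneg fun i => by positivity)
  obtain ⟨r, hΨr, hr⟩ := exists_between (show Ψ < 1 + ∑' i : A, ξ ^ (i : ℕ) by linarith)
  have hr0 : 0 < r := by linarith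
  obtain ⟨K, hK0, hK⟩ := exists_mul_pow_le_card_NCPA hApos hξpos hξsum hξeq
    (div_pos hr0 hξpos) (by rwa [div_mul_cancel₀ _ hξpos.ne'])
  have hlim : Filter.Tendsto (fun n : ℕ => K⁻¹ * (Ψ / r) ^ n)
      (Filter.atTop ⊓ Filter.principal {n : ℕ | (NCPA A n).Nonempty}) (nhds 0) := by
    rw [← mul_zero K⁻¹]
    exact ((tendsto_pow_atTop_nhds_zero_of_lt_one (by positivity)
      ((div_lt_one hr0).2 hΨr)).const_mul _).mono_left inf_le_left
  refine squeeze_zero' (Filter.Eventually.of_forall fun n => by positivity) ?_ hlim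
  refine Filter.eventually_inf_principal.2 (Filter.Eventually.of_forall fun n hn => ?_)
  have h2 := card_filter_mul_pow_le hApos hξpos (fun i => s * g i) hes n
  have h3 : ((NCPA A n).filter fun P => 0 ≤ ∑ B ∈ P, s * g B.card) =
      (NCPA A n).filter fun P => 0 ≤ ∑ B ∈ P, g B.card :=
    Finset.filter_congr fun P _ => by rw [← Finset.mul_sum, mul_nonneg_iff_of_pos_left hs0]
  rw [h3, ← hΨ] at h2
  have hcard : (0 : ℝ) < (NCPA A n).card := by exact_mod_cast hn.card_pos
  rw [← le_div_iff₀ (by positivity)] at h2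
  rw [div_pow, div_le_iff₀ hcard]
  calc _ ≤ Ψ ^ n / ξ ^ n := h2
    _ = K⁻¹ * (Ψ ^ n / r ^ n) * (K * (r ^ n / ξ ^ n)) := by field_simp
    _ ≤ _ := by gcongr; rw [← div_pow]; exact hK n hn

theorem piA_div_one_sub_piA_zero {A : Set ℕ} {ξ : ℝ} (hpos : 0 < ∑' i : A, ξ ^ (i : ℕ)) {k : ℕ}
    (hk : 1 ≤ k) :
    piA A ξ k / (1 - piA A ξ 0) = (if k ∈ A then ξ ^ k else 0) / ∑' i : A, ξ ^ (i : ℕ) := by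
  have hk0 : k ≠ 0 := by omega
  simp only [piA, true_or, if_true, hk0, false_or, pow_zero]
  rw [one_sub_div (by positivity), add_sub_cancel_left]
  split_ifs
  · field_simp
  · simp

theorem tsum_ite_sub_mul {A : Set ℕ} {b : ℕ → ℝ} (hs : Summable fun i : A => b i) (k : ℕ) (c : ℝ) :
    ∑' i : A, ((if (i : ℕ) = k then 1 else 0) - c) * b i =
      (if k ∈ A then b k else 0) - c * ∑' i : A, b i := by
  have h : HasSum (fun i : A => (if (i : ℕ) = k then 1 else 0) * b i)
      (if k ∈ A then b k else 0) := by
    split_ifs with hk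
    · have := hasSum_single (f := fun i : A => (if (i : ℕ) = k then 1 else 0) * b i) ⟨k, hk⟩
        fun i hi => by
          rw [if_neg fun h => hi (Subtype.ext h), zero_mul]
      simpa using this
    · have h0 : ∀ i : A, (if (i : ℕ) = k then 1 else 0) * b i = 0 := fun i => by
        rw [if_neg (fun h : (i : ℕ) = k => hk (h ▸ i.2)), zero_mul]
      simp_rw [h0]
      exact hasSum_zero
  simp_rw [sub_mul]
  exact (h.sub (hs.hasSum.mul_left c)).tsum_eq

theorem sum_ite_card_eq_sub (P : Finset (Finset ℕ)) (k : ℕ) (c : ℝ) :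
    ∑ B ∈ P, ((if B.card = k then 1 else 0) - c) =
      ((P.filter fun B => B.card = k).card : ℝ) - c * P.card := by
  rw [Finset.sum_sub_distrib, Finset.sum_boole, Finset.sum_const, nsmul_eq_mul, mul_comm]

theorem abs_card_filter_div_card_sub_le (P : Finset (Finset ℕ)) (k : ℕ) {θ ε : ℝ} (hθ0 : 0 ≤ θ)
    (hθ1 : θ ≤ 1) (hε : 0 ≤ ε) :
    |((P.filter fun B => B.card = k).card : ℝ) / P.card - θ| ≤
      ε + (if 0 ≤ ∑ B ∈ P, ((if B.card = k then 1 else 0) - (θ + ε)) then 1 else 0) +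
        (if 0 ≤ ∑ B ∈ P, -((if B.card = k then 1 else 0) - (θ - ε)) then 1 else 0) := by
  rw [Finset.sum_neg_distrib, sum_ite_card_eq_sub, sum_ite_card_eq_sub]
  set N : ℝ := ((P.filter fun B => B.card = k).card : ℝ)
  have hN0 : 0 ≤ N / P.card := by positivity
  have hN1 : N / P.card ≤ 1 :=
    div_le_one_of_le₀ (Nat.cast_le.2 (Finset.card_filter_le _ _)) (Nat.cast_nonneg _)
  have h1 : |N / P.card - θ| ≤ 1 := abs_le.2 ⟨by linarith, by linarith⟩
  split_ifs with ha hb hb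
  · linarith
  · linarith
  · linarith
  · have hP : (0 : ℝ) < P.card := by
      refine (Nat.cast_nonneg _).lt_of_ne fun h => ha ?_
      rw [← h, mul_zero, sub_zero]
      exact Nat.cast_nonneg _
    rw [add_zero, add_zero, abs_le]
    have h2 : N / P.card < θ + ε := (div_lt_iff₀ hP).2 (by linarith)
    have h3 : θ - ε < N / P.card := (lt_div_iff₀ hP).2 (by linarith)
    exact ⟨by linarith, by linarith⟩

/-- the size of a uniformly random block of a uniform non-crossing
partition of `[n]` with block sizes in `A` converges in distribution to `π_A(·)/(1 − π_A(0))`. -/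
theorem stmt1 (A : Set ℕ) (hA : A.Nonempty) (hApos : ∀ a ∈ A, 1 ≤ a) (hA1 : A ≠ {1})
    (ξ : ℝ) (hξpos : 0 < ξ)
    (hξsum : Summable fun i : A => (i : ℝ) * ξ ^ (i : ℕ))
    (hξeq : 1 + ∑' i : A, ξ ^ (i : ℕ) = ∑' i : A, (i : ℝ) * ξ ^ (i : ℕ))
    (k : ℕ) (hk : 1 ≤ k) :
    Filter.Tendsto
      (fun n : ℕ =>
        (∑ P ∈ NCPA A n,
            ((P.filter fun B => B.card = k).card : ℝ) / (P.card : ℝ)) /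
          ((NCPA A n).card : ℝ))
      (Filter.atTop ⊓ Filter.principal {n : ℕ | (NCPA A n).Nonempty})
      (nhds (piA A ξ k / (1 - piA A ξ 0))) := by
  have hs := summable_pow_of_summable_mul_pow hApos hξpos hξsum
  obtain ⟨a, ha⟩ := hA
  have hpos : 0 < ∑' i : A, ξ ^ (i : ℕ) :=
    hs.tsum_pos (fun i => by positivity) ⟨a, ha⟩ (by positivity)
  rw [piA_div_one_sub_piA_zero hpos hk]
  set W := ∑' i : A, ξ ^ (i : ℕ) with hW
  set θ := (if k ∈ A then ξ ^ k else 0) / W with hθ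
  have hθW : (if k ∈ A then ξ ^ k else 0) = θ * W := (div_mul_cancel₀ _ hpos.ne').symm
  have hnum : 0 ≤ (if k ∈ A then ξ ^ k else 0) ∧ (if k ∈ A then ξ ^ k else 0) ≤ W := by
    split_ifs with hkA
    · exact ⟨by positivity, hs.le_tsum ⟨k, hkA⟩ fun i _ => by positivity⟩
    · exact ⟨le_rfl, hpos.le⟩
  have hθ0 : 0 ≤ θ := div_nonneg hnum.1 hpos.le
  have hθ1 : θ ≤ 1 := div_le_one_of_le₀ hnum.2 hpos.le
  have habs : ∀ (c : ℝ) (i : ℕ), |(if i = k then (1 : ℝ) else 0) - c| ≤ 1 + |c| := fun c i => by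
    refine (abs_sub _ _).trans (add_le_add_left ?_ _)
    split_ifs <;> simp
  rw [Metric.tendsto_nhds]
  intro ε hε
  have hupper := tendsto_card_filter_div_card hApos hξpos hξsum hξeq
    (g := fun i => (if i = k then 1 else 0) - (θ + ε / 2)) (by positivity) (habs _) (by
      rw [tsum_ite_sub_mul hs, hθW, ← hW]
      nlinarith)
  have hlower := tendsto_card_filter_div_card hApos hξpos hξsum hξeq
    (g := fun i => -((if i = k then 1 else 0) - (θ - ε / 2))) (by positivity)
    (fun i => (abs_neg _).trans_le (habs _ i)) (by
      simp_rw [neg_mul]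
      rw [tsum_neg, tsum_ite_sub_mul hs, hθW, ← hW]
      nlinarith)
  have hsum := hupper.add hlower
  rw [add_zero] at hsum
  filter_upwards [hsum.eventually_lt_const (half_pos hε),
    Filter.mem_inf_of_right (Filter.mem_principal_self _)] with n hn hne
  have hc : (0 : ℝ) < (NCPA A n).card := by exact_mod_cast Finset.card_pos.2 hne
  rw [← add_div, div_lt_iff₀ hc] at hn
  rw [Real.dist_eq, div_sub' hc.ne', abs_div, abs_of_pos hc, div_lt_iff₀ hc]
  have hle : |∑ P ∈ NCPA A n, (((P.filter fun B => B.card = k).card : ℝ) / (P.card : ℝ) - θ)| ≤ _ :=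
    (Finset.abs_sum_le_sum_abs _ _).trans (Finset.sum_le_sum fun P _ =>
      abs_card_filter_div_card_sub_le P k hθ0 hθ1 (half_pos hε).le)
  rw [Finset.sum_sub_distrib, Finset.sum_add_distrib, Finset.sum_add_distrib, Finset.sum_boole,
    Finset.sum_boole, Finset.sum_const, Finset.sum_const, nsmul_eq_mul, nsmul_eq_mul] at hle
  linarith
end
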